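/- arXiv:1706.07653 — 2 statements merged into one kernel-verified Lean document; each statement's English description precedes it below -/
import Mathlib

section
/- Fix a > 2 and y > 1. As n → ∞ along integers n ≡ 2 (mod 4), P^{G1}_{2n}(a,y) is asymptotic to [(a−2)²(y−1)²((a−1)y−1)² / (√(2π)(a−1)³ y^{3/2}(y+1))] · n^{−1/2} · (a(y+1)/√((a−1)y))^n, i.e. the ratio of the two sides tends to 1. -/
open Finset Filter

attribute [local instance] Classical.propDecidable

/-- Height (second coordinate) of a binomial path after `i` steps, starting at height `c`;
steps are encoded by `s : Fin n → Bool` (`true` = up step `(1,1)`, `false` = down step `(1,-1)`).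
The path visits the points `(x₀ + i, hgt c s i)` for `0 ≤ i ≤ n`. -/
def hgt {n : ℕ} (c : ℤ) (s : Fin n → Bool) (i : ℕ) : ℤ :=
  c + ∑ j ∈ Finset.range i, (if h : j < n then (if s ⟨j, h⟩ then (1 : ℤ) else -1) else 0)

/-- The path lies in the upper half-plane (all second coordinates ≥ 0). -/
def InUHP {n : ℕ} (c : ℤ) (s : Fin n → Bool) : Prop :=
  ∀ i ≤ n, 0 ≤ hgt c s i

/-- The number of vertices of the path with second coordinate 0. -/
def visits {n : ℕ} (c : ℤ) (s : Fin n → Bool) : ℕ :=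
  ((Finset.range (n + 1)).filter (fun i => hgt c s i = 0)).card

/-- `s¹_n(k,m)`: the number of pairs `(σ, τ)` of binomial paths of length `n` in the
upper half-plane, with `σ` from `(0,0)` to `(n,m)`, `τ` from `(0,2)` to `(n,k+2)`, and
the second coordinate of `τᵢ` strictly greater than that of `σᵢ` for all `0 ≤ i ≤ n`. -/
noncomputable def s1Count (n k m : ℕ) : ℕ :=
  ((Finset.univ : Finset ((Fin n → Bool) × (Fin n → Bool))).filter
    (fun p => InUHP 0 p.1 ∧ InUHP 2 p.2 ∧ (∀ i ≤ n, hgt 0 p.1 i < hgt 2 p.2 i) ∧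
      hgt 0 p.1 n = (m : ℤ) ∧ hgt 2 p.2 n = (k : ℤ) + 2)).card

/-- `s_n(k,m)`: the sum, over the same pairs `(σ, τ)` as in `s1Count`, of `a` raised to
the number of vertices of the lower path `σ` with second coordinate `0`. -/
noncomputable def sW (a : ℝ) (n k m : ℕ) : ℝ :=
  ∑ p ∈ (Finset.univ : Finset ((Fin n → Bool) × (Fin n → Bool))).filter
      (fun p => InUHP 0 p.1 ∧ InUHP 2 p.2 ∧ (∀ i ≤ n, hgt 0 p.1 i < hgt 2 p.2 i) ∧
        hgt 0 p.1 n = (m : ℤ) ∧ hgt 2 p.2 n = (k : ℤ) + 2),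
    a ^ visits 0 p.1

/-- `P^{G1}_{2n}(a,y) = Σ_{k=0}^{(n-2)/2} (s_{(n-2)/2}(k,0))² y^{k+2}` (for even `n`). -/
noncomputable def PG1 (n : ℕ) (a y : ℝ) : ℝ :=
  ∑ k ∈ Finset.range ((n - 2) / 2 + 1), (sW a ((n - 2) / 2) k 0) ^ 2 * y ^ (k + 2)

namespace PG1aux

noncomputable def FW (a : ℝ) (n : ℕ) (m h : ℤ) : ℝ :=
  ∑ p : (Fin n → Bool) × (Fin n → Bool),
    if (InUHP 0 p.1 ∧ InUHP 2 p.2 ∧ (∀ i ≤ n, hgt 0 p.1 i < hgt 2 p.2 i) ∧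
        hgt 0 p.1 n = m ∧ hgt 2 p.2 n = h) then a ^ visits 0 p.1 else 0

lemma sW_eq (a : ℝ) (n k m : ℕ) : sW a n k m = FW a n m (k + 2) := by
  unfold sW FW
  rw [Finset.sum_filter]

def ep (b : Bool) : ℤ := if b then 1 else -1

lemma hgt_snoc_le {n : ℕ} (c : ℤ) (s : Fin n → Bool) (b : Bool) (i : ℕ) (hi : i ≤ n) :
    hgt c (Fin.snoc s b : Fin (n+1) → Bool) i = hgt c s i := by
  unfold hgt
  congr 1
  apply Finset.sum_congr rfl
  intro j hj
  have hj' : j < n := by have := Finset.mem_range.1 hj; omega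
  have : (⟨j, by omega⟩ : Fin (n+1)) = Fin.castSucc ⟨j, hj'⟩ := rfl
  rw [dif_pos (by omega : j < n+1), dif_pos hj', this, Fin.snoc_castSucc]

lemma hgt_snoc_last {n : ℕ} (c : ℤ) (s : Fin n → Bool) (b : Bool) :
    hgt c (Fin.snoc s b : Fin (n+1) → Bool) (n+1) = hgt c s n + ep b := by
  rw [← hgt_snoc_le c s b n le_rfl]
  have : (⟨n, by omega⟩ : Fin (n+1)) = Fin.last n := rfl
  unfold hgt
  rw [Finset.sum_range_succ, dif_pos (by omega : n < n+1), this, Fin.snoc_last, ep]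
  ring

lemma visits_snoc {n : ℕ} (c : ℤ) (s : Fin n → Bool) (b : Bool) :
    visits c (Fin.snoc s b : Fin (n+1) → Bool)
      = visits c s + if hgt c s n + ep b = 0 then 1 else 0 := by
  unfold visits
  rw [Finset.range_add_one (n := n+1), Finset.filter_insert, hgt_snoc_last]
  have : (Finset.range (n+1)).filter (fun i => hgt c (Fin.snoc s b : Fin (n+1) → Bool) i = 0)
      = (Finset.range (n+1)).filter (fun i => hgt c s i = 0) := by
    apply Finset.filter_congr
    intro i hi
    rw [hgt_snoc_le c s b i (by have := Finset.mem_range.1 hi; omega)]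
  rw [this]
  split_ifs
  · rw [Finset.card_insert_of_notMem (by simp)]
  · simp

lemma forall_le_succ {n : ℕ} (P : ℕ → Prop) :
    (∀ i ≤ n + 1, P i) ↔ (∀ i ≤ n, P i) ∧ P (n+1) := by
  constructor
  · intro h
    exact ⟨fun i hi => h i (by omega), h _ le_rfl⟩
  · rintro ⟨h1, h2⟩ i hi
    rcases Nat.lt_or_ge n i with h | h
    · have : i = n + 1 := by omega
      rw [this]; exact h2
    · exact h1 i h

lemma cond_snoc {n : ℕ} (s t : Fin n → Bool) (b b' : Bool) (m h : ℤ) :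
    (InUHP 0 (Fin.snoc s b : Fin (n+1) → Bool) ∧ InUHP 2 (Fin.snoc t b' : Fin (n+1) → Bool) ∧
      (∀ i ≤ n+1, hgt 0 (Fin.snoc s b : Fin (n+1) → Bool) i
        < hgt 2 (Fin.snoc t b' : Fin (n+1) → Bool) i) ∧
      hgt 0 (Fin.snoc s b : Fin (n+1) → Bool) (n+1) = m ∧
      hgt 2 (Fin.snoc t b' : Fin (n+1) → Bool) (n+1) = h) ↔
    ((0 ≤ m ∧ m < h) ∧ (InUHP 0 s ∧ InUHP 2 t ∧ (∀ i ≤ n, hgt 0 s i < hgt 2 t i) ∧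
        hgt 0 s n = m - ep b ∧ hgt 2 t n = h - ep b')) := by
  have e1 : ∀ (c : ℤ) (s : Fin n → Bool) (b : Bool),
      InUHP c (Fin.snoc s b : Fin (n+1) → Bool) ↔ InUHP c s ∧ 0 ≤ hgt c s n + ep b := by
    intro c s b
    unfold InUHP
    rw [forall_le_succ, hgt_snoc_last]
    constructor
    · rintro ⟨h1, h2⟩
      exact ⟨fun i hi => by rw [← hgt_snoc_le c s b i hi]; exact h1 i hi, h2⟩
    · rintro ⟨h1, h2⟩
      exact ⟨fun i hi => by rw [hgt_snoc_le c s b i hi]; exact h1 i hi, h2⟩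
  have e2 : (∀ i ≤ n+1, hgt 0 (Fin.snoc s b : Fin (n+1) → Bool) i
        < hgt 2 (Fin.snoc t b' : Fin (n+1) → Bool) i) ↔
      (∀ i ≤ n, hgt 0 s i < hgt 2 t i) ∧ hgt 0 s n + ep b < hgt 2 t n + ep b' := by
    rw [forall_le_succ, hgt_snoc_last, hgt_snoc_last]
    constructor
    · rintro ⟨h1, h2⟩
      exact ⟨fun i hi => by
        rw [← hgt_snoc_le 0 s b i hi, ← hgt_snoc_le 2 t b' i hi]; exact h1 i hi, h2⟩
    · rintro ⟨h1, h2⟩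
      exact ⟨fun i hi => by rw [hgt_snoc_le 0 s b i hi, hgt_snoc_le 2 t b' i hi]; exact h1 i hi, h2⟩
  rw [e1, e1, e2, hgt_snoc_last, hgt_snoc_last]
  constructor
  · rintro ⟨⟨h1, h2⟩, ⟨h3, h4⟩, ⟨h5, h6⟩, h7, h8⟩
    exact ⟨⟨by omega, by omega⟩, h1, h3, h5, by omega, by omega⟩
  · rintro ⟨⟨h1, h2⟩, h3, h4, h5, h6, h7⟩
    exact ⟨⟨h3, by omega⟩, ⟨h4, by omega⟩, ⟨h5, by omega⟩, by omega, by omega⟩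

noncomputable def wt (a : ℝ) (m : ℤ) : ℝ := if m = 0 then a else 1

lemma sum_snoc {n : ℕ} (f : (Fin (n+1) → Bool) → ℝ) :
    ∑ s, f s = ∑ b : Bool, ∑ s : Fin n → Bool, f (Fin.snoc s b) := by
  rw [← Fintype.sum_prod_type' (f := fun (b : Bool) (s : Fin n → Bool) => f (Fin.snoc s b))]
  exact (Fintype.sum_equiv (Fin.snocEquiv (fun _ => Bool)) _ _ (fun p => rfl)).symm

lemma FW_succ (a : ℝ) (n : ℕ) (m h : ℤ) :
    FW a (n+1) m h = if 0 ≤ m ∧ m < h then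
      wt a m * (FW a n (m-1) (h-1) + FW a n (m-1) (h+1) + FW a n (m+1) (h-1) + FW a n (m+1) (h+1))
      else 0 := by
  have key : ∀ b b' : Bool, ∀ s t : Fin n → Bool,
      (if (InUHP 0 (Fin.snoc s b : Fin (n+1) → Bool) ∧ InUHP 2 (Fin.snoc t b' : Fin (n+1) → Bool) ∧
      (∀ i ≤ n+1, hgt 0 (Fin.snoc s b : Fin (n+1) → Bool) i
        < hgt 2 (Fin.snoc t b' : Fin (n+1) → Bool) i) ∧
      hgt 0 (Fin.snoc s b : Fin (n+1) → Bool) (n+1) = m ∧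
      hgt 2 (Fin.snoc t b' : Fin (n+1) → Bool) (n+1) = h)
        then a ^ visits 0 (Fin.snoc s b : Fin (n+1) → Bool) else 0)
      = (if 0 ≤ m ∧ m < h then wt a m else 0) *
        (if (InUHP 0 s ∧ InUHP 2 t ∧ (∀ i ≤ n, hgt 0 s i < hgt 2 t i) ∧
        hgt 0 s n = m - ep b ∧ hgt 2 t n = h - ep b') then a ^ visits 0 s else 0) := by
    intro b b' s t
    rw [if_congr (cond_snoc s t b b' m h) rfl rfl, ite_and]
    by_cases h1 : 0 ≤ m ∧ m < h
    · rw [if_pos h1, if_pos h1]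
      split_ifs with h2
      · rw [visits_snoc, pow_add, mul_comm]
        congr 1
        have : hgt 0 s n + ep b = m := by have := h2.2.2.2.1; omega
        rw [this, wt]
        split_ifs <;> simp
      · simp
    · rw [if_neg h1, if_neg h1, zero_mul]
  have : FW a (n+1) m h = (if 0 ≤ m ∧ m < h then wt a m else 0) *
      ∑ b : Bool, ∑ b' : Bool, FW a n (m - ep b) (h - ep b') := by
    unfold FW
    rw [Fintype.sum_prod_type, sum_snoc]
    simp_rw [sum_snoc, key, ← Finset.mul_sum]
    congr 1
    apply Finset.sum_congr rfl
    intro b _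
    rw [Finset.sum_comm]
    apply Finset.sum_congr rfl
    intro b' _
    rw [Fintype.sum_prod_type]
  rw [this]
  split_ifs
  · simp only [Fintype.sum_bool, ep, if_true, if_false, sub_neg_eq_add, Bool.false_eq_true]; ring
  · simp

lemma FW_zero (a : ℝ) (m h : ℤ) :
    FW a 0 m h = if m = 0 ∧ h = 2 then a else 0 := by
  unfold FW
  rw [Fintype.sum_prod_type, Fintype.sum_unique, Fintype.sum_unique]
  simp only [InUHP, hgt, visits]
  have : (0 = m ∧ 2 = h) ↔ (m = 0 ∧ h = 2) := by constructor <;> (rintro ⟨rfl, rfl⟩; simp)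
  simp [this]

/-- one-path evolution -/
noncomputable def ev (a : ℝ) (g : ℤ → ℝ) : ℕ → ℤ → ℝ
  | 0 => g
  | n+1 => fun m => if m < 0 then 0 else wt a m * (ev a g n (m-1) + ev a g n (m+1))

end PG1aux
namespace PG1aux

structure Evo (a : ℝ) (X : ℕ → ℤ → ℝ) : Prop where
  step : ∀ n m, 0 ≤ m → X (n+1) m = wt a m * (X n (m-1) + X n (m+1))
  neg : ∀ n m, m < 0 → X n m = 0
  par : ∀ (n : ℕ) (m : ℤ), (m + n) % 2 ≠ 0 → X n m = 0

lemma FW_ge (a : ℝ) (n : ℕ) (m h : ℤ) (hh : h ≤ m) : FW a n m h = 0 := by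
  cases n with
  | zero => rw [FW_zero, if_neg (by omega)]
  | succ n => rw [FW_succ, if_neg (by omega)]

lemma FW_det (a : ℝ) (X Y : ℕ → ℤ → ℝ) (hX : Evo a X) (hY : Evo a Y)
    (h0 : ∀ m h, m ≤ h → FW a 0 m h = X 0 m * Y 0 h - X 0 h * Y 0 m) (n : ℕ) :
    ∀ m h, m ≤ h → FW a n m h = X n m * Y n h - X n h * Y n m := by
  induction n with
  | zero => exact h0
  | succ n ih =>
    intro m h hmh
    rw [FW_succ]
    split_ifs with hc
    · obtain ⟨h1, h2⟩ := hc
      have e : FW a n (m+1) (h-1) = X n (m+1) * Y n (h-1) - X n (h-1) * Y n (m+1) := by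
        by_cases h3 : m + 1 ≤ h - 1
        · exact ih _ _ h3
        · have h4 : h = m + 1 := by omega
          rw [FW_ge _ _ _ _ (by omega), h4]
          have h5 : m + 1 - 1 = m := by ring
          rw [h5]
          by_cases h6 : (m + n) % 2 = 0
          · rw [hX.par n (m+1) (by omega), hY.par n (m+1) (by omega)]; ring
          · rw [hX.par n m h6, hY.par n m h6]; ring
      rw [e, ih _ _ (by omega), ih _ _ (by omega), ih _ _ (by omega),
        hX.step n m h1, hX.step n h (by omega), hY.step n m h1, hY.step n h (by omega)]
      have : wt a h = 1 := by rw [wt, if_neg (by omega)]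
      rw [this]; ring
    · by_cases hm : m < 0
      · rw [hX.neg _ _ hm, hY.neg _ _ hm]; ring
      · have : m = h := by omega
        rw [this]; ring

noncomputable def AA (a : ℝ) : ℕ → ℤ → ℝ := ev a (fun m => if m = 0 then a else 0)

lemma AA_evo (a : ℝ) : Evo a (AA a) where
  step n m hm := by
    show (if m < 0 then 0 else _) = _
    rw [if_neg (by omega)]; rfl
  neg n m hm := by
    cases n with
    | zero => show (if m = 0 then a else 0) = 0; rw [if_neg (by omega)]
    | succ n => show (if m < 0 then 0 else _) = _; rw [if_pos hm]
  par n := by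
    induction n with
    | zero =>
      intro m hm
      show (if m = 0 then a else 0) = 0
      rw [if_neg]
      rintro rfl
      simp at hm
    | succ n ih =>
      intro m hm
      show (if m < 0 then 0 else wt a m * (AA a n (m-1) + AA a n (m+1))) = _
      push_cast at hm
      rw [ih (m-1) (by omega), ih (m+1) (by omega)]
      simp

noncomputable def cc : ℕ → ℤ → ℝ
  | 0 => fun m => if m = 0 then 1 else 0
  | n+1 => fun m => cc n (m-1) + cc n (m+1)

lemma cc_zero (m : ℤ) : cc 0 m = if m = 0 then 1 else 0 := rfl
lemma cc_succ (n : ℕ) (m : ℤ) : cc (n+1) m = cc n (m-1) + cc n (m+1) := rfl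

lemma cc_neg (n : ℕ) : ∀ m, cc n (-m) = cc n m := by
  induction n with
  | zero => intro m; simp [cc_zero]
  | succ n ih =>
    intro m
    rw [cc_succ, cc_succ, ← ih (m-1), ← ih (m+1), add_comm]
    congr 2 <;> ring

lemma cc_par (n : ℕ) : ∀ m : ℤ, (m + n) % 2 ≠ 0 → cc n m = 0 := by
  induction n with
  | zero => intro m hm; rw [cc_zero, if_neg]; rintro rfl; simp at hm
  | succ n ih =>
    intro m hm
    push_cast at hm
    rw [cc_succ, ih _ (by omega), ih _ (by omega), add_zero]

lemma cc_lt (n : ℕ) : ∀ m : ℤ, m < -n → cc n m = 0 := by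
  induction n with
  | zero => intro m hm; rw [cc_zero, if_neg]; rintro rfl; simp at hm
  | succ n ih =>
    intro m hm
    push_cast at hm
    rw [cc_succ, ih _ (by omega), ih _ (by omega), add_zero]

lemma cc_choose (n : ℕ) : ∀ l : ℕ, cc n (2 * l - n) = (n.choose l : ℝ) := by
  induction n with
  | zero =>
    intro l
    cases l with
    | zero => simp [cc_zero]
    | succ l => rw [cc_zero, if_neg (by push_cast; omega)]; simp
  | succ n ih =>
    intro l
    rw [cc_succ]
    cases l with
    | zero =>
      rw [cc_lt n _ (by push_cast; omega)]
      have := ih 0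
      simp at this ⊢
      exact this
    | succ l =>
      rw [Nat.choose_succ_succ]
      push_cast
      rw [← ih l, ← ih (l+1)]
      push_cast
      congr 2 <;> ring

lemma cc_even (j i : ℕ) : cc (2*j) (2 * i) = ((2*j).choose (j+i) : ℝ) := by
  rw [← cc_choose]
  congr 1; push_cast; ring

noncomputable def ww (n : ℕ) (m : ℤ) : ℝ := cc n (m-1) - cc n (m+1)

lemma ww_zero (n : ℕ) : ww n 0 = 0 := by
  have := cc_neg n 1
  simp [ww, this]

lemma ww_succ (n : ℕ) (m : ℤ) : ww (n+1) m = ww n (m-1) + ww n (m+1) := by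
  simp only [ww, cc_succ]
  ring_nf

lemma ww_par (n : ℕ) (m : ℤ) (h : (m + n) % 2 ≠ 1) : ww n m = 0 := by
  rw [ww, cc_par _ _ (by omega), cc_par _ _ (by omega), sub_zero]

noncomputable def EE (a : ℝ) (n : ℕ) (m : ℤ) : ℝ :=
  if m < 0 then 0 else if m = 0 then - (a / (a-1)) * ww n 1 else ww n (m-1) - ww n (m+1) / (a-1)

lemma EE_evo (a : ℝ) (ha : 2 < a) : Evo a (EE a) where
  step n m hm := by
    have hb : a - 1 ≠ 0 := by linarith
    rcases eq_or_lt_of_le hm with h | h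
    · subst h
      simp only [EE, wt]
      simp only [lt_irrefl, if_true, if_false, zero_sub, zero_add]
      norm_num
      have := ww_succ n 1
      norm_num at this
      rw [this, ww_zero]
      field_simp
      ring
    · rcases eq_or_lt_of_le (show 1 ≤ m by omega) with h1 | h1
      · subst h1
        simp only [EE, wt]
        norm_num
        rw [ww_zero, ww_succ]
        norm_num
        field_simp
        ring
      · simp only [EE, wt]
        rw [if_neg (by omega), if_neg (by omega), if_neg (by omega), if_neg (by omega),
          if_neg (by omega), if_neg (by omega), if_neg (by omega), ww_succ, ww_succ]
        ring_nf
  neg n m hm := by simp only [EE]; rw [if_pos hm]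
  par n m hm := by
    simp only [EE]
    split_ifs with h1 h2
    · rfl
    · rw [ww_par _ _ (by omega), mul_zero]
    · rw [ww_par _ _ (by omega), ww_par _ _ (by omega)]; simp

lemma FW_eq (a : ℝ) (ha : 2 < a) (n : ℕ) (m h : ℤ) (hmh : m ≤ h) :
    FW a n m h = AA a n m * EE a n h - AA a n h * EE a n m := by
  refine FW_det a _ _ (AA_evo a) (EE_evo a ha) ?_ n m h hmh
  intro m h hmh
  have hb : a - 1 ≠ 0 := by linarith
  rw [FW_zero]
  have e : ∀ m, EE a 0 m = if m = 0 then -(a/(a-1)) else if m = 2 then 1 else 0 := by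
    intro m
    simp only [EE, ww, cc_zero]
    by_cases h0 : m = 0
    · subst h0; norm_num
    by_cases h2 : m = 2
    · subst h2; norm_num
    by_cases h1 : m < 0
    · simp [h0, h1, h2]
    rw [if_neg h1, if_neg h0, if_neg h0, if_neg h2, if_neg (by omega), if_neg (by omega),
      if_neg (by omega), if_neg (by omega)]
    simp
  have e2 : ∀ m, AA a 0 m = if m = 0 then a else 0 := fun m => rfl
  rw [e, e, e2, e2]
  by_cases h0 : m = 0
  · subst h0
    by_cases h1 : h = 0
    · subst h1; norm_num
    · simp [h1]
  · simp only [h0, false_and, if_false]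
    by_cases h1 : h = 0
    · subst h1; have : m ≠ 2 := by omega
      simp [this]
    · simp [h1]

lemma AA_V (a : ℝ) (n : ℕ) : ∀ m : ℤ, 1 ≤ m →
    AA a n (m-1) - (a-1) * AA a n (m+1) = a * ww n m := by
  induction n with
  | zero =>
    intro m hm
    have e2 : ∀ m, AA a 0 m = if m = 0 then a else 0 := fun m => rfl
    simp only [e2, ww, cc_zero]
    rw [if_neg (by omega : ¬ m + 1 = 0), if_neg (by omega : ¬ m + 1 = 0)]
    split_ifs <;> simp
  | succ n ih =>
    intro m hm
    have hs := (AA_evo a).step n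
    rw [hs _ (by omega), hs _ (by omega), ww_succ, mul_add a, ← ih (m+1) (by omega)]
    have w1 : wt a (m+1) = 1 := by rw [wt, if_neg (by omega)]
    rw [w1]
    rcases eq_or_lt_of_le hm with h | h
    · subst h
      norm_num [wt]
      rw [ww_zero, (AA_evo a).neg n (-1) (by norm_num)]
      ring
    · rw [← ih (m-1) (by omega)]
      have w2 : wt a (m-1) = 1 := by rw [wt, if_neg (by omega)]
      rw [w2]; ring_nf

lemma AA_nonneg (a : ℝ) (ha : 2 < a) (n : ℕ) : ∀ m, 0 ≤ AA a n m := by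
  induction n with
  | zero => intro m; show 0 ≤ if m = 0 then a else 0; split_ifs <;> linarith
  | succ n ih =>
    intro m
    by_cases hm : m < 0
    · rw [(AA_evo a).neg _ _ hm]
    · rw [(AA_evo a).step _ _ (by omega)]
      apply mul_nonneg
      · rw [wt]; split_ifs <;> linarith
      · exact add_nonneg (ih _) (ih _)

lemma AA_le (a : ℝ) (ha : 2 < a) (t : ℝ) (ht : 0 < t) (hbt : (a-1) * t^2 ≤ 1) (n : ℕ) :
    ∀ m : ℤ, AA a n m ≤ a * (t + t⁻¹)^n * t ^ m := by
  have hpos : ∀ (n : ℕ) (m : ℤ), 0 ≤ a * (t + t⁻¹)^n * t ^ m := by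
    intro n m; have : 0 < a := by linarith
    positivity
  induction n with
  | zero =>
    intro m
    show (if m = 0 then a else 0) ≤ _
    split_ifs with h
    · subst h; simp
    · exact hpos 0 m
  | succ n ih =>
    intro m
    rcases lt_trichotomy m 0 with hm | hm | hm
    · rw [(AA_evo a).neg _ _ hm]; exact hpos _ _
    · subst hm
      rw [(AA_evo a).step _ _ le_rfl, (AA_evo a).neg n (0-1) (by norm_num), wt, if_pos rfl, zero_add]
      have h1 := ih (0+1)
      have h2 : a * t ≤ t + t⁻¹ := by
        have : (a-1) * t ≤ t⁻¹ := by
          rw [inv_eq_one_div, le_div_iff₀ ht]; nlinarith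
        linarith
      have h3 : 0 ≤ a * (t + t⁻¹)^n := by have : 0 < a := by linarith
                                          positivity
      calc a * AA a n (0+1) ≤ a * (a * (t + t⁻¹)^n * t ^ (0+1:ℤ)) :=
            mul_le_mul_of_nonneg_left h1 (by linarith)
        _ = a * (t + t⁻¹)^n * (a * t) := by simp; ring
        _ ≤ a * (t + t⁻¹)^n * (t + t⁻¹) := mul_le_mul_of_nonneg_left h2 h3
        _ = _ := by simp; ring
    · rw [(AA_evo a).step _ _ hm.le, wt, if_neg (by omega), one_mul]
      have h1 := ih (m-1)
      have h2 := ih (m+1)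
      rw [zpow_sub_one₀ ht.ne'] at h1
      rw [zpow_add_one₀ ht.ne'] at h2
      calc _ ≤ _ := add_le_add h1 h2
        _ = _ := by ring

/-- explicit values -/
lemma EE_even (a : ℝ) (j i : ℕ) : EE a (2*j) (2 * i + 2) =
    ((2*j).choose (j+i) : ℝ) - (1 + 1/(a-1)) * ((2*j).choose (j+i+1) : ℝ)
      + 1/(a-1) * ((2*j).choose (j+i+2) : ℝ) := by
  simp only [EE, ww]
  rw [if_neg (by omega), if_neg (by omega)]
  have h1 := cc_even j i
  have h2 := cc_even j (i+1)
  have h3 := cc_even j (i+2)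
  rw [← add_assoc] at h2 h3
  rw [← h1, ← h2, ← h3]
  push_cast
  ring_nf

lemma ww_one (j : ℕ) : ww (2*j) 1 = (catalan j : ℝ) := by
  have h1 := cc_even j 0
  have h2 := cc_even j 1
  norm_num at h1 h2
  rw [ww]; norm_num
  rw [h1, h2]
  have h3 : (j+1) * catalan j = (2*j).choose j := by
    rw [catalan_eq_centralBinom_div]
    have := succ_mul_catalan_eq_centralBinom j
    rw [← catalan_eq_centralBinom_div, this]; rfl
  have h4 := Nat.choose_succ_right_eq (2*j) j
  have h5 : 2 * j - j = j := by omega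
  rw [h5] at h4
  have h3' : ((j:ℝ)+1) * catalan j = (2*j).choose j := by exact_mod_cast h3
  have h4' : ((2*j).choose (j+1) : ℝ) * ((j:ℝ)+1) = (2*j).choose j * j := by exact_mod_cast h4
  have hj : (j:ℝ) + 1 ≠ 0 := by positivity
  apply mul_left_cancel₀ hj
  rw [h3']
  linarith

lemma AA_rec (a : ℝ) (ha : 2 < a) (j : ℕ) :
    AA a (2*(j+1)) 0 = a^2/(a-1) * (AA a (2*j) 0 - catalan j) := by
  have hb : a - 1 ≠ 0 := by linarith
  have hV := AA_V a (2*j) 1 le_rfl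
  rw [ww_one] at hV
  norm_num at hV
  have e : 2*(j+1) = 2*j+1+1 := by ring
  rw [e, (AA_evo a).step _ _ le_rfl, (AA_evo a).neg _ (0-1) (by norm_num), zero_add,
    (AA_evo a).step _ _ (by norm_num)]
  norm_num [wt]
  have : AA a (2*j) 2 = (AA a (2*j) 0 - a * catalan j) / (a-1) := by
    field_simp; linarith
  rw [this]; field_simp; ring

lemma AA_limit (a : ℝ) (ha : 2 < a) :
    Tendsto (fun j : ℕ => AA a (2*j) 0 / (a^2/(a-1))^j) atTop (nhds (a*(a-2)/(a-1))) := by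
  have hb : 0 < a - 1 := by linarith
  set x : ℝ := (a-1)/a^2 with hx
  have hx0 : 0 < x := by positivity
  have hx4 : x ≤ 1/4 := by
    rw [hx, div_le_div_iff₀ (by positivity) (by norm_num)]; nlinarith [sq_nonneg (a-2)]
  have e : ∀ j, AA a (2*j) 0 / (a^2/(a-1))^j = a - ∑ i ∈ range j, (catalan i : ℝ) * x^i := by
    intro j
    have hinv : ∀ j : ℕ, ((a^2/(a-1))^j)⁻¹ = x^j := by
      intro j; rw [← inv_pow, inv_div]
    induction j with
    | zero => simp; rfl
    | succ j ih =>
      rw [div_eq_mul_inv, hinv] at ih ⊢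
      rw [AA_rec a ha, Finset.sum_range_succ, ← sub_sub, ← ih, pow_succ]
      have : a^2/(a-1) * x = 1 := by rw [hx]; field_simp
      linear_combination (AA a (2*j) 0 - catalan j) * x^j * this
  have hrec : ∀ n, (∑ i ∈ range (n+1), (catalan i : ℝ) * x^i)
      ≤ 1 + x * (∑ i ∈ range n, (catalan i : ℝ) * x^i)^2 := by
    intro n
    rw [Finset.sum_range_succ']
    simp only [catalan_zero, pow_zero]
    have : ∑ k ∈ range n, (catalan (k+1) : ℝ) * x^(k+1) = x * ∑ k ∈ range n,
        ∑ p ∈ antidiagonal k, ((catalan p.1 : ℝ) * x^p.1) * (catalan p.2 * x^p.2) := by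
      rw [Finset.mul_sum]
      apply Finset.sum_congr rfl
      intro k _
      rw [catalan_succ', Finset.mul_sum]
      push_cast
      rw [Finset.sum_mul]
      apply Finset.sum_congr rfl
      intro p hp
      rw [← HasAntidiagonal.mem_antidiagonal.1 hp]; ring
    rw [this]
    have h2 : ∑ k ∈ range n,
        ∑ p ∈ antidiagonal k, ((catalan p.1 : ℝ) * x^p.1) * (catalan p.2 * x^p.2)
        ≤ (∑ i ∈ range n, (catalan i : ℝ) * x^i)^2 := by
      rw [sq, Finset.sum_mul_sum, ← Finset.sum_product', Finset.sum_sigma']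
      rw [← Finset.sum_image (f := fun p : ℕ × ℕ => ((catalan p.1 : ℝ) * x^p.1) * (catalan p.2 * x^p.2)) (g := fun s : (_ : ℕ) × ℕ × ℕ => s.2)]
      · apply Finset.sum_le_sum_of_subset_of_nonneg
        · intro p hp
          simp only [Finset.mem_image, Finset.mem_sigma, Finset.mem_range, HasAntidiagonal.mem_antidiagonal] at hp
          obtain ⟨s, ⟨h1, h2⟩, rfl⟩ := hp
          simp only [Finset.mem_product, Finset.mem_range]
          omega
        · intros; positivity
      · rintro ⟨k, p⟩ h1 ⟨k', p'⟩ h2 h3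
        simp at h1 h2 h3
        subst h3
        obtain ⟨_, rfl⟩ := h1
        obtain ⟨_, rfl⟩ := h2
        rfl
    push_cast
    nlinarith
  have hbd : ∀ n, (∑ i ∈ range n, (catalan i : ℝ) * x^i) ≤ 2 := by
    intro n
    induction n with
    | zero => simp
    | succ n ih =>
      have h0 : 0 ≤ ∑ i ∈ range n, (catalan i : ℝ) * x^i := Finset.sum_nonneg (fun i _ => by positivity)
      refine (hrec n).trans ?_
      nlinarith
  have hsum : Summable (fun i : ℕ => (catalan i : ℝ) * x^i) :=
    summable_of_sum_range_le (fun i => by positivity) hbd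
  set C := ∑' i : ℕ, (catalan i : ℝ) * x^i with hC
  have hC2 : C ≤ 2 := hsum.tsum_le_of_sum_range_le hbd
  have hCeq : C = 1 + x * C^2 := by
    have hn : Summable (fun i : ℕ => ‖(catalan i : ℝ) * x^i‖) := hsum.norm
    have := tsum_mul_tsum_eq_tsum_sum_antidiagonal_of_summable_norm hn hn
    rw [← hC] at this
    rw [sq, this, ← tsum_mul_left]
    conv_lhs => rw [hC, hsum.tsum_eq_zero_add]
    simp only [catalan_zero, pow_zero]
    congr 1
    · norm_num
    · congr 1
      ext k
      rw [catalan_succ', Finset.mul_sum]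
      push_cast
      rw [Finset.sum_mul]
      apply Finset.sum_congr rfl
      intro p hp
      rw [← HasAntidiagonal.mem_antidiagonal.1 hp]; ring
  have hCval : C = a/(a-1) := by
    have h1 : (C - a) * ((a-1) * C - a) = 0 := by
      have : a^2 * C = a^2 + (a-1) * C^2 := by
        have h := congrArg (fun z => a^2 * z) hCeq
        simp only [hx] at h
        rw [h]; field_simp
      linarith
    rcases mul_eq_zero.1 h1 with h | h
    · linarith
    · field_simp; linarith
  simp_rw [e]
  have := (hsum.hasSum.tendsto_sum_nat).const_sub a
  rw [← hC, hCval] at this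
  convert this using 2
  field_simp; ring

end PG1aux
namespace PG1aux

lemma int_cos (k : ℤ) : ∫ θ in (-Real.pi)..Real.pi, Real.cos (k * θ) =
    if k = 0 then 2 * Real.pi else 0 := by
  split_ifs with h
  · subst h; simp; ring
  · have hk : (k:ℝ) ≠ 0 := by exact_mod_cast h
    rw [intervalIntegral.integral_comp_mul_left (fun x => Real.cos x) hk, integral_cos]
    simp [Real.sin_int_mul_pi]

lemma normSq_sum (c : ℕ → ℝ) (n : ℕ) (θ : ℝ) :
    Complex.normSq (∑ l ∈ range n, (c l : ℂ) * Complex.exp (θ * Complex.I) ^ l)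
     = ∑ l ∈ range n, ∑ m ∈ range n, c l * c m * Real.cos (((l:ℤ) - (m:ℤ) : ℤ) * θ) := by
  have h : ∀ l : ℕ, Complex.exp (θ * Complex.I) ^ l
      = (Real.cos (l * θ) : ℂ) + (Real.sin (l * θ) : ℂ) * Complex.I := by
    intro l
    rw [← Complex.exp_nat_mul, ← mul_assoc, Complex.exp_mul_I]
    push_cast
    rfl
  rw [Complex.normSq_apply]
  have hre : (∑ l ∈ range n, (c l : ℂ) * Complex.exp (θ * Complex.I) ^ l).re
      = ∑ l ∈ range n, c l * Real.cos (l * θ) := by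
    rw [Complex.re_sum]
    apply Finset.sum_congr rfl
    intro l _
    rw [h, Complex.re_ofReal_mul]
    simp [-Complex.ofReal_cos, -Complex.ofReal_sin]
  have him : (∑ l ∈ range n, (c l : ℂ) * Complex.exp (θ * Complex.I) ^ l).im
      = ∑ l ∈ range n, c l * Real.sin (l * θ) := by
    rw [Complex.im_sum]
    apply Finset.sum_congr rfl
    intro l _
    rw [h, Complex.im_ofReal_mul]
    simp [-Complex.ofReal_cos, -Complex.ofReal_sin]
  rw [hre, him, Finset.sum_mul_sum, Finset.sum_mul_sum, ← Finset.sum_add_distrib]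
  apply Finset.sum_congr rfl
  intro l _
  rw [← Finset.sum_add_distrib]
  apply Finset.sum_congr rfl
  intro m _
  push_cast
  rw [sub_mul, Real.cos_sub]
  ring

lemma parseval (c : ℕ → ℝ) (n : ℕ) :
    ∫ θ in (-Real.pi)..Real.pi,
      Complex.normSq (∑ l ∈ range n, (c l : ℂ) * Complex.exp (θ * Complex.I) ^ l)
      = 2 * Real.pi * ∑ l ∈ range n, c l ^ 2 := by
  simp_rw [normSq_sum]
  rw [intervalIntegral.integral_finsetSum]
  · rw [Finset.mul_sum]
    apply Finset.sum_congr rfl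
    intro l hl
    rw [intervalIntegral.integral_finsetSum]
    · simp_rw [intervalIntegral.integral_const_mul, int_cos]
      rw [Finset.sum_eq_single l]
      · simp; ring
      · intro m _ hm
        rw [if_neg (by omega), mul_zero]
      · intro h; exact absurd hl h
    · intro m _
      apply Continuous.intervalIntegrable
      fun_prop
  · intro l _
    apply Continuous.intervalIntegrable
    fun_prop

/-- coefficients of `(1+X)^N (X-1)(X-β)` -/
noncomputable def qq (β : ℝ) (N : ℕ) : Polynomial ℝ :=
  (1 + Polynomial.X)^N * ((Polynomial.X - 1) * (Polynomial.X - Polynomial.C β))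

lemma qq_coeff (β : ℝ) (N l : ℕ) : (qq β N).coeff (l+2) =
    (N.choose l : ℝ) - (1 + β) * (N.choose (l+1) : ℝ) + β * (N.choose (l+2) : ℝ) := by
  have : qq β N = (1 + Polynomial.X)^N * Polynomial.X * Polynomial.X
     - Polynomial.C (1+β) * ((1 + Polynomial.X)^N * Polynomial.X)
     + Polynomial.C β * (1 + Polynomial.X)^N := by
    rw [qq, Polynomial.C_add]; simp only [map_one]; ring
  rw [this, Polynomial.coeff_add, Polynomial.coeff_sub, Polynomial.coeff_C_mul,
    Polynomial.coeff_C_mul, Polynomial.coeff_mul_X, Polynomial.coeff_mul_X, Polynomial.coeff_mul_X,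
    Polynomial.coeff_one_add_X_pow, Polynomial.coeff_one_add_X_pow, Polynomial.coeff_one_add_X_pow]

lemma qq_deg (β : ℝ) (N : ℕ) : (qq β N).natDegree < N + 3 := by
  have h : (qq β N).natDegree ≤ N * 1 + (1 + 1) := by
    unfold qq
    refine Polynomial.natDegree_mul_le_of_le (Polynomial.natDegree_pow_le_of_le _ ?_)
      (Polynomial.natDegree_mul_le_of_le ?_ ?_)
    · compute_degree
    · compute_degree
    · compute_degree
  omega

lemma qq_coeff_bound (β : ℝ) (h0 : 0 ≤ β) (h1 : β ≤ 1) (N l : ℕ) :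
    |(qq β N).coeff l| ≤ 4 * 2^N := by
  have hc : ∀ l, (0:ℝ) ≤ ((1 + Polynomial.X : Polynomial ℝ)^N).coeff l ∧ ((1 + Polynomial.X : Polynomial ℝ)^N).coeff l ≤ 2^N := by
    intro l
    rw [Polynomial.coeff_one_add_X_pow]
    exact ⟨by positivity, by exact_mod_cast Nat.choose_le_two_pow N l⟩
  have hcX : ∀ (p : Polynomial ℝ), (∀ l, 0 ≤ p.coeff l ∧ p.coeff l ≤ 2^N) →
      ∀ l, 0 ≤ (p * Polynomial.X).coeff l ∧ (p * Polynomial.X).coeff l ≤ 2^N := by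
    intro p hp l
    cases l with
    | zero => simp
    | succ l => rw [Polynomial.coeff_mul_X]; exact hp l
  have : qq β N = (1 + Polynomial.X)^N * Polynomial.X * Polynomial.X
     - Polynomial.C (1+β) * ((1 + Polynomial.X)^N * Polynomial.X)
     + Polynomial.C β * (1 + Polynomial.X)^N := by
    rw [qq, Polynomial.C_add]; simp only [map_one]; ring
  rw [this, Polynomial.coeff_add, Polynomial.coeff_sub, Polynomial.coeff_C_mul,
    Polynomial.coeff_C_mul]
  have a1 := hc l
  have a2 := hcX _ hc l
  have a3 := hcX _ (hcX _ hc) l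
  have hp : (0:ℝ) < 2^N := by positivity
  rw [abs_le]
  constructor <;> nlinarith [a1.1, a1.2, a2.1, a2.2, a3.1, a3.2]

noncomputable def ff (β y θ : ℝ) : ℝ :=
  (1 + y^2 - 2*y*Real.cos θ) * (y^2 + β^2 - 2*y*β*Real.cos θ)

lemma sum_eq_integral (β y : ℝ) (N : ℕ) :
    2 * Real.pi * ∑ l ∈ range (N+3), y^(2*l) * (qq β N).coeff l ^ 2 =
    ∫ θ in (-Real.pi)..Real.pi, ff β y θ * (1 + y^2 + 2*y*Real.cos θ)^N := by
  have h := parseval (fun l => y^l * (qq β N).coeff l) (N+3)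
  have e1 : ∑ l ∈ range (N+3), y^(2*l) * (qq β N).coeff l ^ 2
     = ∑ l ∈ range (N+3), (y^l * (qq β N).coeff l) ^ 2 :=
    Finset.sum_congr rfl (fun l _ => by ring)
  rw [e1, ← h]
  apply intervalIntegral.integral_congr
  intro θ _
  simp only
  have e2 : (∑ l ∈ range (N+3), (((y^l * (qq β N).coeff l : ℝ)) : ℂ) * Complex.exp (θ * Complex.I) ^ l)
     = ((qq β N).map (Complex.ofRealHom)).eval (y * Complex.exp (θ * Complex.I)) := by
    rw [Polynomial.eval_eq_sum_range' (n := N+3)]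
    · apply Finset.sum_congr rfl
      intro l _
      rw [Polynomial.coeff_map, mul_pow]
      push_cast
      simp only [Complex.ofRealHom_eq_coe]
      ring
    · exact lt_of_le_of_lt Polynomial.natDegree_map_le (qq_deg β N)
  rw [e2]
  simp only [qq, Polynomial.map_mul, Polynomial.map_pow, Polynomial.map_add, Polynomial.map_sub,
    Polynomial.map_one, Polynomial.map_X, Polynomial.map_C, Polynomial.eval_mul,
    Polynomial.eval_pow, Polynomial.eval_add, Polynomial.eval_sub, Polynomial.eval_one,
    Polynomial.eval_X, Polynomial.eval_C, Complex.ofRealHom_eq_coe, map_mul, map_pow]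
  have e3 : ∀ r : ℝ, Complex.normSq (y * Complex.exp (θ * Complex.I) - r)
      = y^2 + r^2 - 2*y*r*Real.cos θ := by
    intro r
    rw [Complex.normSq_apply, Complex.exp_mul_I, ← Complex.ofReal_cos, ← Complex.ofReal_sin]
    simp [-Complex.ofReal_cos, -Complex.ofReal_sin]
    nlinarith [Real.sin_sq_add_cos_sq θ]
  have e4 := e3 1
  have e5 := e3 (-1)
  have e6 : (1:ℂ) + y * Complex.exp (θ * Complex.I) = y * Complex.exp (θ * Complex.I) - ((-1 : ℝ) : ℂ) := by
    push_cast; ring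
  rw [e6, e5, e3]
  rw [Complex.ofReal_one] at e4
  rw [e4, ff]
  ring

lemma laplace (f : ℝ → ℝ) (hf : Continuous f) (κ : ℝ) (h0 : 0 < κ) (h1 : κ ≤ 1/2) :
    Tendsto (fun N : ℕ => Real.sqrt N * ∫ θ in (-Real.pi)..Real.pi,
       f θ * (1 - κ * (1 - Real.cos θ))^N) atTop (nhds (f 0 * Real.sqrt (2*Real.pi/κ))) := by
  obtain ⟨K, hK⟩ := (isCompact_Icc (a := -Real.pi) (b := Real.pi)).exists_bound_of_continuousOn hf.continuousOn
  have hK0 : 0 ≤ K := (norm_nonneg _).trans (hK 0 ⟨by linarith [Real.pi_pos], Real.pi_pos.le⟩)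
  have hpi := Real.pi_pos
  let G : ℕ → ℝ → ℝ := fun N t => Set.indicator (Set.Ioc (-Real.pi * Real.sqrt N) (Real.pi * Real.sqrt N))
    (fun t => f (t / Real.sqrt N) * (1 - κ * (1 - Real.cos (t / Real.sqrt N)))^N) t
  have hG : ∀ᶠ N : ℕ in atTop, ∫ t, G N t = Real.sqrt N * ∫ θ in (-Real.pi)..Real.pi,
       f θ * (1 - κ * (1 - Real.cos θ))^N := by
    filter_upwards [eventually_gt_atTop 0] with N hN
    have hs : 0 < Real.sqrt N := Real.sqrt_pos.2 (by exact_mod_cast hN)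
    simp only [G]
    rw [MeasureTheory.integral_indicator measurableSet_Ioc,
      ← intervalIntegral.integral_of_le (by nlinarith)]
    rw [intervalIntegral.integral_comp_div (fun θ => f θ * (1 - κ * (1 - Real.cos θ))^N) hs.ne']
    rw [mul_div_cancel_right₀ _ hs.ne', mul_div_cancel_right₀ _ hs.ne', smul_eq_mul]
  have hlim : ∫ t : ℝ, f 0 * Real.exp (-(κ/2) * t^2) = f 0 * Real.sqrt (2*Real.pi/κ) := by
    rw [MeasureTheory.integral_const_mul, integral_gaussian]
    congr 2; field_simp
  rw [← hlim]
  refine Tendsto.congr' hG ?_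
  apply MeasureTheory.tendsto_integral_of_dominated_convergence
    (fun t => K * Real.exp (-(2*κ/Real.pi^2) * t^2))
  · intro N
    apply Measurable.aestronglyMeasurable
    apply Measurable.indicator _ measurableSet_Ioc
    apply Continuous.measurable
    fun_prop
  · exact (integrable_exp_neg_mul_sq (by positivity)).const_mul K
  · intro N
    refine Filter.Eventually.of_forall (fun t => ?_)
    simp only [G]
    by_cases ht : t ∈ Set.Ioc (-Real.pi * Real.sqrt N) (Real.pi * Real.sqrt N)
    · rw [Set.indicator_of_mem ht, norm_mul]
      have hs : 0 < Real.sqrt N := by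
        by_contra hcon
        have : Real.sqrt N = 0 := le_antisymm (not_lt.1 hcon) (Real.sqrt_nonneg _)
        rw [this] at ht; simp at ht
      have hx : |t / Real.sqrt N| ≤ Real.pi := by
        rw [abs_le]
        constructor
        · rw [le_div_iff₀ hs]; exact ht.1.le
        · rw [div_le_iff₀ hs]; exact ht.2
      have hb := hK (t / Real.sqrt N) (abs_le.1 hx)
      have hcos := Real.cos_le_one_sub_mul_cos_sq hx
      refine mul_le_mul hb ?_ (norm_nonneg _) hK0
      have hbase0 : 0 ≤ 1 - κ * (1 - Real.cos (t / Real.sqrt N)) := by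
        nlinarith [Real.neg_one_le_cos (t / Real.sqrt N)]
      rw [norm_pow, Real.norm_of_nonneg hbase0]
      have hbase : 1 - κ * (1 - Real.cos (t / Real.sqrt N))
          ≤ Real.exp (-(2*κ/Real.pi^2) * (t / Real.sqrt N)^2) := by
        have h3 := Real.add_one_le_exp (-(2*κ/Real.pi^2) * (t / Real.sqrt N)^2)
        have h4 : κ * (2 / Real.pi ^ 2 * (t / Real.sqrt N) ^ 2) ≤ κ * (1 - Real.cos (t / Real.sqrt N)) :=
          mul_le_mul_of_nonneg_left (by linarith) h0.le
        have h5 : κ * (2 / Real.pi ^ 2 * (t / Real.sqrt N) ^ 2)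
          = -(-(2*κ/Real.pi^2) * (t / Real.sqrt N)^2) := by ring
        linarith
      refine (pow_le_pow_left₀ hbase0 hbase N).trans (le_of_eq ?_)
      rw [← Real.exp_nat_mul]
      congr 1
      have hN2 : (N:ℝ) = Real.sqrt N ^ 2 := (Real.sq_sqrt (by positivity)).symm
      generalize Real.sqrt N = r at *
      rw [hN2]
      field_simp
    · rw [Set.indicator_of_notMem ht, norm_zero]
      positivity
  · refine Filter.Eventually.of_forall (fun t => ?_)
    have hsq : Tendsto (fun N : ℕ => Real.sqrt N) atTop atTop :=
      Real.tendsto_sqrt_atTop.comp tendsto_natCast_atTop_atTop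
    have ht0 : Tendsto (fun N : ℕ => t / Real.sqrt N) atTop (nhds 0) := hsq.const_div_atTop t
    have hev : ∀ᶠ N : ℕ in atTop, f (t / Real.sqrt N) * (1 + -(κ * (1 - Real.cos (t / Real.sqrt N))))^N = G N t := by
      filter_upwards [hsq.eventually_gt_atTop (|t|/Real.pi)] with N hN
      simp only [G]
      rw [Set.indicator_of_mem]
      · rfl
      · rw [div_lt_iff₀ hpi, mul_comm, abs_lt] at hN
        exact ⟨by linarith [hN.1], hN.2.le⟩
    refine Tendsto.congr' hev ?_
    refine Tendsto.mul ?_ ?_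
    · exact (hf.tendsto 0).comp ht0
    · have := @Real.tendsto_one_add_pow_exp_of_tendsto (fun N : ℕ => -(κ * (1 - Real.cos (t / Real.sqrt N)))) (-(κ/2) * t^2) ?_
      · exact this
      have hsinc : Tendsto (fun N : ℕ => -(κ/2) * t^2 * (Real.sinc (t / Real.sqrt N / 2))^2) atTop (nhds (-(κ/2) * t^2 * 1^2)) := by
        refine Tendsto.const_mul _ (Tendsto.pow ?_ 2)
        have h2 : Tendsto (fun N : ℕ => t / Real.sqrt N / 2) atTop (nhds 0) := by
          simpa using ht0.div_const 2
        have := (Real.continuous_sinc.tendsto 0).comp h2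
        rwa [Real.sinc_zero] at this
      rw [one_pow, mul_one] at hsinc
      refine Tendsto.congr' ?_ hsinc
      filter_upwards [eventually_gt_atTop 0] with N hN
      have hs : 0 < Real.sqrt N := Real.sqrt_pos.2 (by exact_mod_cast hN)
      by_cases htz : t = 0
      · subst htz; simp
      have hne : t / Real.sqrt N / 2 ≠ 0 := by positivity
      rw [Real.sinc_of_ne_zero hne]
      have hc : Real.cos (t / Real.sqrt N) = 1 - 2 * Real.sin (t / Real.sqrt N / 2)^2 := by
        have := Real.cos_sq' (t / Real.sqrt N / 2)
        have h2 := Real.cos_two_mul (t / Real.sqrt N / 2)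
        rw [show 2 * (t / Real.sqrt N / 2) = t / Real.sqrt N by ring] at h2
        rw [h2, this]; ring
      rw [hc]
      have hN2 : (N:ℝ) = Real.sqrt N ^ 2 := (Real.sq_sqrt (by positivity)).symm
      generalize Real.sin (t / Real.sqrt N / 2) = S
      generalize Real.sqrt N = r at *
      rw [hN2]
      field_simp
      ring

end PG1aux
namespace PG1aux

lemma polyexp (C r : ℝ) (h0 : 0 ≤ r) (h1 : r < 1) :
    Tendsto (fun j : ℕ => C * ((2*j+4)^2 * r^j)) atTop (nhds 0) := by
  have a2 := tendsto_pow_const_mul_const_pow_of_lt_one 2 h0 h1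
  have a1 := tendsto_pow_const_mul_const_pow_of_lt_one 1 h0 h1
  have a0 := tendsto_pow_const_mul_const_pow_of_lt_one 0 h0 h1
  have := (((a2.const_mul 4).add (a1.const_mul 16)).add (a0.const_mul 16)).const_mul C
  simp only [mul_zero, add_zero] at this
  refine this.congr (fun j => ?_)
  ring

lemma sqrt_le (j : ℕ) : Real.sqrt (2*j : ℕ) ≤ 2*j+4 := by
  rw [Real.sqrt_le_left (by positivity)]
  push_cast
  nlinarith [(Nat.cast_nonneg j : (0:ℝ) ≤ j)]

lemma sum_even (G : ℕ → ℝ) (h : ∀ i, G (2*i+1) = 0) (j : ℕ) :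
    ∑ k ∈ range (2*j+1), G k = ∑ i ∈ range (j+1), G (2*i) := by
  induction j with
  | zero => simp
  | succ j ih =>
    rw [Finset.sum_range_succ _ (j+1), ← ih, show 2*(j+1)+1 = 2*j+1+1+1 by ring,
      Finset.sum_range_succ, Finset.sum_range_succ, h, add_zero]
    congr 2

noncomputable def SS (a y : ℝ) (j : ℕ) : ℝ :=
  ∑ l ∈ range (2*j+3), y^(2*l) * (qq (1/(a-1)) (2*j)).coeff l ^ 2

noncomputable def UU (a y : ℝ) (j : ℕ) : ℝ :=
  ∑ k ∈ range (2*j+1), EE a (2*j) (k+2) ^ 2 * y^(k+2)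

noncomputable def WW (a y : ℝ) (j : ℕ) : ℝ :=
  ∑ k ∈ range (2*j+1), (AA a (2*j) (k+2) * EE a (2*j) 0) ^ 2 * y^(k+2)

noncomputable def ZZ (a y : ℝ) (j : ℕ) : ℝ :=
  ∑ k ∈ range (2*j+1), EE a (2*j) (k+2) * (AA a (2*j) (k+2) * EE a (2*j) 0) * y^(k+2)

lemma PG1_eq (a y : ℝ) (ha : 2 < a) (j : ℕ) :
    PG1 (4*j+2) a y = (AA a (2*j) 0)^2 * UU a y j - 2 * AA a (2*j) 0 * ZZ a y j + WW a y j := by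
  have e : (4*j+2-2)/2 = 2*j := by omega
  unfold PG1 UU ZZ WW
  rw [e, Finset.mul_sum, Finset.mul_sum, ← Finset.sum_sub_distrib, ← Finset.sum_add_distrib]
  apply Finset.sum_congr rfl
  intro k _
  rw [sW_eq, FW_eq a ha _ _ _ (by push_cast; omega)]
  push_cast
  ring

lemma ZZ_sq (a y : ℝ) (hy : 1 < y) (j : ℕ) : (ZZ a y j)^2 ≤ UU a y j * WW a y j := by
  have h0 : 0 ≤ y := by linarith
  have := Finset.sum_mul_sq_le_sq_mul_sq (range (2*j+1))
    (fun k => EE a (2*j) (k+2) * Real.sqrt (y^(k+2)))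
    (fun k => AA a (2*j) (k+2) * EE a (2*j) 0 * Real.sqrt (y^(k+2)))
  have hs : ∀ k : ℕ, Real.sqrt (y^(k+2)) ^ 2 = y^(k+2) := fun k => Real.sq_sqrt (by positivity)
  unfold ZZ UU WW
  refine le_of_eq_of_le ?_ (this.trans (le_of_eq ?_))
  · congr 1
    apply Finset.sum_congr rfl
    intro k _
    linear_combination -(EE a (2*j) (k+2) * (AA a (2*j) (k+2) * EE a (2*j) 0)) * hs k
  · congr 1
    · apply Finset.sum_congr rfl
      intro k _
      rw [mul_pow _ (Real.sqrt _) 2, hs k]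
    · apply Finset.sum_congr rfl
      intro k _
      rw [mul_pow _ (Real.sqrt _) 2, hs k]

lemma SS_lim (a y : ℝ) (hy : 1 < y) :
    Tendsto (fun j : ℕ => Real.sqrt (2*j:ℕ) * SS a y j / (1+y)^(4*j)) atTop
      (nhds ((y-1)^2*(y-1/(a-1))^2 * Real.sqrt (2*Real.pi/(2*y/(1+y)^2)) / (2*Real.pi))) := by
  have hpi := Real.pi_pos
  have hc : Continuous (ff (1/(a-1)) y) := by unfold ff; fun_prop
  have hκ : 2*y/(1+y)^2 ≤ 1/2 := by
    rw [div_le_div_iff₀ (by positivity) (by norm_num)]; nlinarith [sq_nonneg (y-1)]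
  have L := (laplace _ hc (2*y/(1+y)^2) (by positivity) hκ).comp
    (tendsto_id.const_mul_atTop' (show 0 < 2 by norm_num) : Tendsto (fun j : ℕ => 2*j) atTop atTop)
  have L2 := L.div_const (2*Real.pi)
  have e0 : ff (1/(a-1)) y 0 = (y-1)^2*(y-1/(a-1))^2 := by
    simp only [ff, Real.cos_zero]; ring
  rw [e0] at L2
  refine L2.congr (fun j => ?_)
  simp only [Function.comp]
  have h := sum_eq_integral (1/(a-1)) y (2*j)
  have e1 : ∀ θ, ff (1/(a-1)) y θ * (1 + y^2 + 2*y*Real.cos θ)^(2*j)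
     = (1+y)^(4*j) * (ff (1/(a-1)) y θ * (1 - 2*y/(1+y)^2 * (1 - Real.cos θ))^(2*j)) := by
    intro θ
    have : 1 + y^2 + 2*y*Real.cos θ = (1+y)^2 * (1 - 2*y/(1+y)^2 * (1 - Real.cos θ)) := by
      field_simp; ring
    rw [this, mul_pow, ← pow_mul]
    ring
  simp_rw [e1] at h
  rw [intervalIntegral.integral_const_mul] at h
  unfold SS
  have hy4 : (1+y)^(4*j) ≠ 0 := by positivity
  rw [div_eq_div_iff (by positivity) hy4]
  linear_combination (-Real.sqrt (2*j:ℕ)) * h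

lemma UU_SS (a y : ℝ) (ha : 2 < a) (j : ℕ) :
    y^(2*j+2) * UU a y j = SS a y j -
      ∑ l ∈ range (j+2), y^(2*l) * (qq (1/(a-1)) (2*j)).coeff l ^ 2 := by
  unfold UU SS
  rw [sum_even, show 2*j+3 = (j+2) + (j+1) by ring, Finset.sum_range_add _ (j+2), add_sub_cancel_left,
    Finset.mul_sum]
  · apply Finset.sum_congr rfl
    intro i _
    rw [show j + 2 + i = j + i + 2 by ring, qq_coeff, ← EE_even]
    push_cast
    ring
  · intro i
    rw [(EE_evo a ha).par _ _ (by push_cast; omega)]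
    ring

lemma UU_lim (a y : ℝ) (ha : 2 < a) (hy : 1 < y) :
    Tendsto (fun j : ℕ => Real.sqrt (2*j:ℕ) * UU a y j / ((1+y)^2/y)^(2*j)) atTop
      (nhds ((y-1)^2*(y-1/(a-1))^2 * Real.sqrt (2*Real.pi/(2*y/(1+y)^2)) / (2*Real.pi) / y^2)) := by
  have hy0 : 0 < y := by linarith
  have hβ0 : 0 ≤ 1/(a-1) := by apply div_nonneg <;> linarith
  have hβ1 : 1/(a-1) ≤ 1 := by rw [div_le_one (by linarith)]; linarith
  set r : ℝ := 16 * y^2/(1+y)^4 with hr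
  have hr0 : 0 ≤ r := by positivity
  have hr1 : r < 1 := by
    rw [hr, div_lt_one (by positivity)]
    have : 4 * y < (1+y)^2 := by nlinarith [sq_pos_of_pos (show 0 < y - 1 by linarith)]
    nlinarith
  let rem : ℕ → ℝ := fun j => ∑ l ∈ range (j+2), y^(2*l) * (qq (1/(a-1)) (2*j)).coeff l ^ 2
  have hrem : Tendsto (fun j : ℕ => Real.sqrt (2*j:ℕ) * rem j / (1+y)^(4*j)) atTop (nhds 0) := by
    refine squeeze_zero ?_ ?_ (polyexp (16*y^2) r hr0 hr1)
    · intro j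
      have : 0 ≤ rem j := Finset.sum_nonneg (fun l _ => by positivity)
      positivity
    · intro j
      have h1 : rem j ≤ (2*j+4) * (y^(2*j+2) * (16 * 16^j)) := by
        have : rem j ≤ (range (j+2)).card • (y^(2*j+2) * (16 * 16^j : ℝ)) := by
          apply Finset.sum_le_card_nsmul
          intro l hl
          have hl' : l < j+2 := Finset.mem_range.1 hl
          have hq := qq_coeff_bound (1/(a-1)) hβ0 hβ1 (2*j) l
          apply mul_le_mul
          · exact pow_le_pow_right₀ hy.le (by omega)
          · rw [← sq_abs]
            calc _ ≤ (4 * 2^(2*j) : ℝ)^2 := pow_le_pow_left₀ (abs_nonneg _) hq 2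
              _ = _ := by rw [mul_pow, ← pow_mul, show 2*j*2 = 4*j by ring, pow_mul]; norm_num
          · positivity
          · positivity
        refine this.trans ?_
        rw [Finset.card_range, nsmul_eq_mul]
        apply mul_le_mul_of_nonneg_right _ (by positivity)
        push_cast
        linarith [(Nat.cast_nonneg j : (0:ℝ) ≤ j)]
      calc _ ≤ (2*j+4) * ((2*j+4) * (y^(2*j+2) * (16 * 16^j))) / (1+y)^(4*j) := by
            apply div_le_div_of_nonneg_right _ (by positivity)
            exact mul_le_mul (sqrt_le j) h1 (Finset.sum_nonneg (fun l _ => by positivity)) (by positivity)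
        _ = _ := by
            rw [hr, div_pow, mul_pow, ← pow_mul, ← pow_mul]; ring
  have := ((SS_lim a y hy).sub hrem).div_const (y^2)
  rw [sub_zero] at this
  refine this.congr (fun j => ?_)
  have h := UU_SS a y ha j
  have h' : SS a y j = y^(2*j+2) * UU a y j + rem j := by simp only [rem]; linarith
  rw [h', div_pow, ← pow_mul, show 2*(2*j) = 4*j by ring]
  field_simp
  ring

lemma catalan_le (j : ℕ) : (catalan j : ℝ) ≤ 4^j := by
  have h1 := succ_mul_catalan_eq_centralBinom j
  have h2 : catalan j ≤ 4^j := by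
    have : j.centralBinom ≤ 2^(2*j) := Nat.choose_le_two_pow _ _
    rw [pow_mul] at this
    norm_num at this
    nlinarith [Nat.zero_le (j * catalan j)]
  exact_mod_cast h2

lemma WW_lim (a y : ℝ) (ha : 2 < a) (hy : 1 < y) :
    Tendsto (fun j : ℕ => Real.sqrt (2*j:ℕ) * WW a y j /
      ((a^2/(a-1))^(2*j) * ((1+y)^2/y)^(2*j))) atTop (nhds 0) := by
  have hy0 : 0 < y := by linarith
  have hb0 : 0 < a - 1 := by linarith
  have hg : ∀ M : ℝ, 1 < M → 4 < (1+M)^2/M := by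
    intro M hM
    rw [lt_div_iff₀ (by linarith)]
    nlinarith [sq_pos_of_pos (show 0 < M - 1 by linarith)]
  have hΛ : a^2/(a-1) = (1 + (a-1))^2/(a-1) := by ring
  have hb4 := hg (a-1) (by linarith)
  have hy4 := hg y hy
  rw [← hΛ] at hb4
  set Λ := a^2/(a-1)
  set Y := (1+y)^2/y
  set M := max (a-1) y with hM
  have hM1 : 1 < M := lt_max_of_lt_right hy
  have hM0 : 0 < M := by linarith
  have hμ : 4 * ((1+M)^2/M) < Λ * Y := by
    rcases max_choice (a-1) y with h | h
    · rw [← hM] at h; rw [h, ← hΛ]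
      show 4 * Λ < _
      nlinarith
    · rw [← hM] at h; rw [h]
      show 4 * Y < _
      nlinarith
  set t := (Real.sqrt M)⁻¹ with ht
  have hsM : 0 < Real.sqrt M := Real.sqrt_pos.2 hM0
  have ht0 : 0 < t := by positivity
  have ht2 : t^2 = M⁻¹ := by rw [ht, inv_pow, Real.sq_sqrt hM0.le]
  have hbt : (a-1) * t^2 ≤ 1 := by
    rw [ht2, ← div_eq_mul_inv, div_le_one hM0]; exact le_max_left _ _
  have hyt : t^2 * y ≤ 1 := by
    rw [ht2, mul_comm, ← div_eq_mul_inv, div_le_one hM0]; exact le_max_right _ _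
  have hμ2 : (t + t⁻¹)^2 = (1+M)^2/M := by
    have : t⁻¹^2 = M := by rw [inv_pow, ht2, inv_inv]
    have h2 : t * t⁻¹ = 1 := mul_inv_cancel₀ ht0.ne'
    have : (t + t⁻¹)^2 = M⁻¹ + 2 + M := by
      rw [add_sq, ht2, this]; linear_combination 2 * h2
    rw [this]; field_simp; ring
  set μ := (1+M)^2/M
  have hμ0 : 0 < μ := by positivity
  set r := (4 * μ / (Λ * Y))^2 with hr
  have hΛY : 0 < Λ * Y := by nlinarith
  have hr1 : r < 1 := by
    rw [hr]
    have : 4 * μ / (Λ * Y) < 1 := by rw [div_lt_one hΛY]; exact hμ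
    have h0 : 0 ≤ 4 * μ / (Λ * Y) := by positivity
    nlinarith
  refine squeeze_zero ?_ ?_ (polyexp (a^2 * (a/(a-1))^2) r (by positivity) hr1)
  · intro j
    have : 0 ≤ WW a y j := Finset.sum_nonneg (fun l _ => by positivity)
    have h1 : 0 < Λ := by linarith
    have h2 : 0 < Y := by linarith
    positivity
  · intro j
    have h1 : WW a y j ≤ (2*j+4) * (a^2 * (a/(a-1))^2 * (μ^(2*j) * 16^j)) := by
      have : WW a y j ≤ (range (2*j+1)).card • (a^2 * (a/(a-1))^2 * (μ^(2*j) * 16^j)) := by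
        apply Finset.sum_le_card_nsmul
        intro k _
        have hA := AA_le a ha t ht0 hbt (2*j) (k+2)
        have hA0 := AA_nonneg a ha (2*j) (k+2)
        have hA2 := pow_le_pow_left₀ hA0 hA 2
        have hE : EE a (2*j) 0 ^ 2 ≤ (a/(a-1))^2 * 16^j := by
          have : EE a (2*j) 0 = -(a/(a-1)) * catalan j := by
            rw [EE, if_neg (by norm_num), if_pos rfl, ww_one]
          rw [this, mul_pow, neg_sq]
          apply mul_le_mul_of_nonneg_left _ (by positivity)
          calc _ ≤ ((4:ℝ)^j)^2 := pow_le_pow_left₀ (by positivity) (catalan_le j) 2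
            _ = _ := by rw [← pow_mul, mul_comm, pow_mul]; norm_num
        have e1 : (a * (t + t⁻¹)^(2*j) * t^((k:ℤ)+2))^2 = a^2 * μ^(2*j) * (t^2)^(k+2) := by
          have : t^((k:ℤ)+2) = t^(k+2) := by exact_mod_cast zpow_natCast t (k+2)
          rw [this, ← hμ2, ← pow_mul]; ring
        rw [e1] at hA2
        calc (AA a (2*j) (k+2) * EE a (2*j) 0) ^ 2 * y^(k+2)
            = AA a (2*j) (k+2)^2 * EE a (2*j) 0 ^ 2 * y^(k+2) := by ring
          _ ≤ (a^2 * μ^(2*j) * (t^2)^(k+2)) * ((a/(a-1))^2 * 16^j) * y^(k+2) := by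
              apply mul_le_mul_of_nonneg_right _ (by positivity)
              exact mul_le_mul hA2 hE (by positivity) (by positivity)
          _ = (a^2 * (a/(a-1))^2 * (μ^(2*j) * 16^j)) * (t^2*y)^(k+2) := by rw [mul_pow (t^2) y]; ring
          _ ≤ (a^2 * (a/(a-1))^2 * (μ^(2*j) * 16^j)) * 1 := by
              apply mul_le_mul_of_nonneg_left _ (by positivity)
              exact pow_le_one₀ (by positivity) hyt
          _ = _ := mul_one _
      refine this.trans ?_
      rw [Finset.card_range, nsmul_eq_mul]
      apply mul_le_mul_of_nonneg_right _ (by positivity)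
      push_cast
      linarith
    rw [← mul_pow]
    calc _ ≤ (2*j+4) * ((2*j+4) * (a^2 * (a/(a-1))^2 * (μ^(2*j) * 16^j))) / (Λ*Y)^(2*j) := by
            apply div_le_div_of_nonneg_right _ (by positivity)
            exact mul_le_mul (sqrt_le j) h1 (Finset.sum_nonneg (fun l _ => by positivity)) (by positivity)
      _ = _ := by
          rw [hr, ← pow_mul, div_pow (4*μ), mul_pow 4 μ, pow_mul 4 2 j]; norm_num; ring

lemma main_lim (a y : ℝ) (ha : 2 < a) (hy : 1 < y) :
    Tendsto (fun j : ℕ => Real.sqrt (2*j:ℕ) * PG1 (4*j+2) a y /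
      ((a^2/(a-1))^(2*j) * ((1+y)^2/y)^(2*j))) atTop
      (nhds ((a*(a-2)/(a-1))^2 *
        ((y-1)^2*(y-1/(a-1))^2 * Real.sqrt (2*Real.pi/(2*y/(1+y)^2)) / (2*Real.pi) / y^2))) := by
  have hy0 : 0 < y := by linarith
  have hb0 : 0 < a - 1 := by linarith
  have hX := AA_limit a ha
  have hU := UU_lim a y ha hy
  have hW := WW_lim a y ha hy
  have hΛ0 : 0 < a^2/(a-1) := by positivity
  have hY0 : 0 < (1+y)^2/y := by positivity
  set Λ := a^2/(a-1)
  set Y := (1+y)^2/y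
  have hZ : Tendsto (fun j : ℕ => Real.sqrt (2*j:ℕ) * ZZ a y j / (Λ^j * Y^(2*j))) atTop (nhds 0) := by
    have h1 := hU.mul hW
    rw [mul_zero] at h1
    have h2 := h1.sqrt
    rw [Real.sqrt_zero] at h2
    refine squeeze_zero_norm (fun j => ?_) h2
    rw [Real.norm_eq_abs]
    apply Real.abs_le_sqrt
    have h3 := ZZ_sq a y hy j
    calc _ = (Real.sqrt (2*j:ℕ))^2 * (ZZ a y j)^2 / (Λ^(2*j) * Y^(2*j) * Y^(2*j)) := by ring
      _ ≤ (Real.sqrt (2*j:ℕ))^2 * (UU a y j * WW a y j) / (Λ^(2*j) * Y^(2*j) * Y^(2*j)) := by gcongr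
      _ = _ := by ring
  have := (((hX.pow 2).mul hU).sub ((hX.mul hZ).const_mul 2)).add hW
  rw [mul_zero, mul_zero, sub_zero, add_zero] at this
  refine this.congr (fun j => ?_)
  rw [PG1_eq a y ha]
  ring

end PG1aux

/-- Asymptotics of `P^{G1}_{2n}(a,y)` for `a > 2`, `y > 1`, along `n ≡ 2 (mod 4)`:
the ratio of the two sides tends to `1`. -/
theorem PG1_asymp_abig_ybig (a y : ℝ) (ha : 2 < a) (hy : 1 < y) :
    Tendsto (fun j : ℕ =>
        PG1 (4 * j + 2) a y /
          ((a - 2) ^ 2 * (y - 1) ^ 2 * ((a - 1) * y - 1) ^ 2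
              / (Real.sqrt (2 * Real.pi) * (a - 1) ^ 3 * y ^ ((3 : ℝ) / 2) * (y + 1))
            * ((4 * j + 2 : ℕ) : ℝ) ^ (-(1 : ℝ) / 2)
            * (a * (y + 1) / Real.sqrt ((a - 1) * y)) ^ (4 * j + 2)))
      atTop (nhds 1) := by
  have hy0 : 0 < y := by linarith
  have hb0 : 0 < a - 1 := by linarith
  have ha2 : 0 < a - 2 := by linarith
  have hy1 : 0 < y - 1 := by linarith
  have hby : 0 < (a-1)*y - 1 := by nlinarith
  have hpi := Real.pi_pos
  have H := PG1aux.main_lim a y ha hy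
  have hrat : Tendsto (fun j : ℕ => Real.sqrt ((4*j+2 : ℕ):ℝ) / Real.sqrt (2*j:ℕ)) atTop
      (nhds (Real.sqrt 2)) := by
    have h1 : Tendsto (fun j : ℕ => 2 + ((j:ℝ))⁻¹) atTop (nhds (2 + 0)) :=
      tendsto_const_nhds.add (tendsto_inv_atTop_zero.comp tendsto_natCast_atTop_atTop)
    rw [add_zero] at h1
    refine h1.sqrt.congr' ?_
    filter_upwards [eventually_gt_atTop 0] with j hj
    have hj' : (0:ℝ) < j := by exact_mod_cast hj
    rw [← Real.sqrt_div (by positivity)]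
    congr 1
    push_cast
    field_simp
    ring
  set K : ℝ := (a - 2) ^ 2 * (y - 1) ^ 2 * ((a - 1) * y - 1) ^ 2
              / (Real.sqrt (2 * Real.pi) * (a - 1) ^ 3 * y ^ ((3 : ℝ) / 2) * (y + 1)) with hK
  have hK0 : 0 < K := by positivity
  have hT := (H.mul hrat).div_const (K * (a^2/(a-1) * ((1+y)^2/y)))
  have hone : (a*(a-2)/(a-1))^2 *
        ((y-1)^2*(y-1/(a-1))^2 * Real.sqrt (2*Real.pi/(2*y/(1+y)^2)) / (2*Real.pi) / y^2)
        * Real.sqrt 2 / (K * (a^2/(a-1) * ((1+y)^2/y))) = 1 := by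
    have e1 : Real.sqrt (2*Real.pi/(2*y/(1+y)^2)) = Real.sqrt Real.pi * (1+y) / Real.sqrt y := by
      rw [show 2*Real.pi/(2*y/(1+y)^2) = (Real.pi * (1+y)^2) / y by field_simp,
        Real.sqrt_div (by positivity), Real.sqrt_mul hpi.le, Real.sqrt_sq (by positivity)]
    have e2 : y ^ ((3:ℝ)/2) = y * Real.sqrt y := by
      rw [Real.sqrt_eq_rpow, show (3:ℝ)/2 = 1 + 1/2 by norm_num, Real.rpow_add hy0, Real.rpow_one]
    have e3 : Real.sqrt (2*Real.pi) = Real.sqrt 2 * Real.sqrt Real.pi :=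
      Real.sqrt_mul (by norm_num) _
    have s2 : Real.sqrt 2 ^ 2 = 2 := Real.sq_sqrt (by norm_num)
    have sp : Real.sqrt Real.pi ^ 2 = Real.pi := Real.sq_sqrt hpi.le
    have p2 : 0 < Real.sqrt 2 := by positivity
    have pp : 0 < Real.sqrt Real.pi := by positivity
    have py : 0 < Real.sqrt y := by positivity
    rw [hK, e1, e2, e3]
    have e4 : y - 1/(a-1) = ((a-1)*y-1)/(a-1) := by field_simp
    rw [e4]
    generalize (a-1)*y-1 = w at *
    generalize y - 1 = v at *
    generalize a - 2 = u at *
    generalize a - 1 = b at *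
    have e5 : Real.pi = Real.sqrt Real.pi ^ 2 := sp.symm
    generalize Real.sqrt Real.pi = q at *
    generalize Real.sqrt y = z at *
    generalize Real.sqrt 2 = c at *
    rw [e5]
    have ha0 : a ≠ 0 := by linarith
    rw [div_eq_one_iff_eq (by positivity)]
    field_simp
    linear_combination (1+y) * s2
  rw [hone] at hT
  refine hT.congr' ?_
  filter_upwards [eventually_gt_atTop 0] with j hj
  have hj' : (0:ℝ) < j := by exact_mod_cast hj
  have f1 : (a * (y + 1) / Real.sqrt ((a - 1) * y)) ^ (4 * j + 2)
      = (a^2/(a-1) * ((1+y)^2/y)) * ((a^2/(a-1))^(2*j) * ((1+y)^2/y)^(2*j)) := by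
    have : (a * (y + 1) / Real.sqrt ((a - 1) * y))^2 = a^2/(a-1) * ((1+y)^2/y) := by
      rw [div_pow, Real.sq_sqrt (by positivity)]; field_simp; ring
    rw [show 4*j+2 = 2*(2*j+1) by ring, pow_mul, this, pow_succ, mul_pow]; ring
  have f2 : ((4 * j + 2 : ℕ) : ℝ) ^ (-(1 : ℝ) / 2) = (Real.sqrt ((4*j+2 : ℕ):ℝ))⁻¹ := by
    rw [neg_div, Real.rpow_neg (by positivity), Real.sqrt_eq_rpow]
  rw [f1, f2]
  have g1 : 0 < Real.sqrt ((4*j+2 : ℕ):ℝ) := by positivity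
  have g2 : 0 < Real.sqrt ((2*j : ℕ):ℝ) := Real.sqrt_pos.2 (by push_cast; positivity)
  have g3 : 0 < a^2/(a-1) := by positivity
  have g4 : 0 < (1+y)^2/y := by positivity
  generalize Real.sqrt ((4*j+2 : ℕ):ℝ) = r1 at *
  generalize Real.sqrt ((2*j : ℕ):ℝ) = r2 at *
  generalize a^2/(a-1) = L at *
  generalize (1+y)^2/y = Y at *
  field_simp
end

section
/- Fix a > 2 and y > 1. As n → ∞ along integers n ≡ 2 (mod 4), P^{G2}_{2n}(a,y) is asymptotic to [(a−2)(y−1)²((a−1)y−1)² / (√(2π) a (a−1)³ y^{3/2}(y+1))] · n^{−1/2} · (a(y+1)/√((a−1)y))^n, and as n → ∞ along integers n ≡ 0 (mod 4), P^{G2}_{2n}(a,y) is asymptotic to [(a−2)(y−1)²((a−1)y−1)² / (√(2π) a (a−1)² y^{3/2}(y+1))] · n^{−1/2} · (a(y+1)/√((a−1)y))^n. -/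
open Finset Filter

attribute [local instance] Classical.propDecidable

/-- `P^{G2}_{2n}(a,y) = Σ_{k=0}^{(n-2)/2} Σ_{m=1}^{k} (s_{(n-2)/2}(k,m))² y^{k+2}`
(for even `n`). -/
noncomputable def PG2 (n : ℕ) (a y : ℝ) : ℝ :=
  ∑ k ∈ Finset.range ((n - 2) / 2 + 1), ∑ m ∈ Finset.Icc 1 k,
    (sW a ((n - 2) / 2) k m) ^ 2 * y ^ (k + 2)

/-- sign of a step -/
def sgn (b : Bool) : ℤ := if b then 1 else -1

lemma hgt_snoc_le {n : ℕ} (c : ℤ) (s : Fin n → Bool) (b : Bool) (i : ℕ) (hi : i ≤ n) :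
    hgt c (Fin.snoc (α := fun _ => Bool) s b : Fin (n + 1) → Bool) i = hgt c s i := by
  unfold hgt
  congr 1
  apply Finset.sum_congr rfl
  intro j hj
  have hj' : j < n := lt_of_lt_of_le (Finset.mem_range.mp hj) hi
  have h2 : j < n + 1 := by omega
  simp [hj', h2, Fin.snoc]

lemma hgt_snoc_last {n : ℕ} (c : ℤ) (s : Fin n → Bool) (b : Bool) :
    hgt c (Fin.snoc (α := fun _ => Bool) s b : Fin (n + 1) → Bool) (n + 1) = hgt c s n + sgn b := by
  have h := hgt_snoc_le c s b n le_rfl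
  unfold hgt at h ⊢
  rw [Finset.sum_range_succ, ← add_assoc, h]
  simp [Fin.snoc, sgn]

lemma inUHP_snoc {n : ℕ} (c : ℤ) (s : Fin n → Bool) (b : Bool) :
    InUHP c (Fin.snoc (α := fun _ => Bool) s b : Fin (n + 1) → Bool) ↔
      InUHP c s ∧ 0 ≤ hgt c s n + sgn b := by
  unfold InUHP
  constructor
  · intro h
    refine ⟨fun i hi => ?_, ?_⟩
    · rw [← hgt_snoc_le c s b i hi]; exact h i (by omega)
    · rw [← hgt_snoc_last]; exact h _ le_rfl
  · rintro ⟨h1, h2⟩ i hi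
    rcases Nat.lt_or_ge n i with h | h
    · obtain rfl : i = n + 1 := by omega
      rw [hgt_snoc_last]; exact h2
    · rw [hgt_snoc_le c s b i h]; exact h1 i h

lemma lt_snoc {n : ℕ} (c d : ℤ) (s t : Fin n → Bool) (b b' : Bool) :
    (∀ i ≤ n + 1, hgt c (Fin.snoc (α := fun _ => Bool) s b : Fin (n + 1) → Bool) i <
      hgt d (Fin.snoc (α := fun _ => Bool) t b' : Fin (n + 1) → Bool) i) ↔
      (∀ i ≤ n, hgt c s i < hgt d t i) ∧ hgt c s n + sgn b < hgt d t n + sgn b' := by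
  constructor
  · intro h
    refine ⟨fun i hi => ?_, ?_⟩
    · rw [← hgt_snoc_le c s b i hi, ← hgt_snoc_le d t b' i hi]; exact h i (by omega)
    · rw [← hgt_snoc_last, ← hgt_snoc_last]; exact h _ le_rfl
  · rintro ⟨h1, h2⟩ i hi
    rcases Nat.lt_or_ge n i with h | h
    · obtain rfl : i = n + 1 := by omega
      rw [hgt_snoc_last, hgt_snoc_last]; exact h2
    · rw [hgt_snoc_le c s b i h, hgt_snoc_le d t b' i h]; exact h1 i h

lemma visits_snoc {n : ℕ} (c : ℤ) (s : Fin n → Bool) (b : Bool) :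
    visits c (Fin.snoc (α := fun _ => Bool) s b : Fin (n + 1) → Bool) =
      visits c s + if hgt c s n + sgn b = 0 then 1 else 0 := by
  unfold visits
  rw [Finset.range_add_one, Finset.filter_insert, hgt_snoc_last]
  have : (Finset.range (n + 1)).filter
      (fun i => hgt c (Fin.snoc (α := fun _ => Bool) s b : Fin (n + 1) → Bool) i = 0) =
      (Finset.range (n + 1)).filter (fun i => hgt c s i = 0) := by
    apply Finset.filter_congr
    intro i hi
    rw [hgt_snoc_le c s b i (by have := Finset.mem_range.mp hi; omega)]
  rw [this]
  split_ifs with h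
  · rw [Finset.card_insert_of_notMem (by simp)]
  · simp

/-- admissible pair of paths with given end heights -/
def Adm {n : ℕ} (s t : Fin n → Bool) (m l : ℤ) : Prop :=
  InUHP 0 s ∧ InUHP 2 t ∧ (∀ i ≤ n, hgt 0 s i < hgt 2 t i) ∧ hgt 0 s n = m ∧ hgt 2 t n = l

lemma adm_snoc {n : ℕ} (s t : Fin n → Bool) (b b' : Bool) (m l : ℤ) (hm : 0 ≤ m) (hl : m < l) :
    Adm (Fin.snoc (α := fun _ => Bool) s b : Fin (n + 1) → Bool)
      (Fin.snoc (α := fun _ => Bool) t b' : Fin (n + 1) → Bool) m l ↔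
      Adm s t (m - sgn b) (l - sgn b') := by
  unfold Adm
  rw [inUHP_snoc, inUHP_snoc, lt_snoc, hgt_snoc_last, hgt_snoc_last]
  constructor
  · rintro ⟨⟨h1, h2⟩, ⟨h3, h4⟩, ⟨h5, h6⟩, h7, h8⟩
    exact ⟨h1, h3, h5, by omega, by omega⟩
  · rintro ⟨h1, h3, h5, h7, h8⟩
    exact ⟨⟨h1, by omega⟩, ⟨h3, by omega⟩, ⟨h5, by omega⟩, by omega, by omega⟩

/-- weighted sum over pairs, integer end heights -/
noncomputable def SS (a : ℝ) (n : ℕ) (m l : ℤ) : ℝ :=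
  ∑ s : Fin n → Bool, ∑ t : Fin n → Bool, if Adm s t m l then a ^ visits 0 s else 0

lemma sW_eq_SS (a : ℝ) (n k m : ℕ) : sW a n k m = SS a n m (k + 2) := by
  unfold sW SS
  rw [Finset.sum_filter, Fintype.sum_prod_type]
  apply Finset.sum_congr rfl
  intro s _
  apply Finset.sum_congr rfl
  intro t _
  unfold Adm
  congr 1

lemma SS_eq_zero (a : ℝ) (n : ℕ) (m l : ℤ) (h : m < 0 ∨ l ≤ m) : SS a n m l = 0 := by
  unfold SS
  apply Finset.sum_eq_zero
  intro s _
  apply Finset.sum_eq_zero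
  intro t _
  rw [if_neg]
  rintro ⟨h1, -, h3, h4, h5⟩
  have := h1 n le_rfl
  have := h3 n le_rfl
  omega

lemma sum_snoc {n : ℕ} (f : (Fin (n + 1) → Bool) → ℝ) :
    ∑ s, f s = ∑ b : Bool, ∑ s : Fin n → Bool,
      f (Fin.snoc (α := fun _ => Bool) s b : Fin (n + 1) → Bool) := by
  rw [← Fintype.sum_prod_type' (f := fun (b : Bool) (s : Fin n → Bool) =>
    f (Fin.snoc (α := fun _ => Bool) s b : Fin (n + 1) → Bool))]
  exact (Fintype.sum_equiv (Fin.snocEquiv (fun _ => Bool)) _ _ (fun x => rfl)).symm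

lemma SS_succ (a : ℝ) (n : ℕ) (m l : ℤ) (hm : 0 ≤ m) (hl : m < l) :
    SS a (n + 1) m l = (if m = 0 then a else 1) *
      (SS a n (m - 1) (l - 1) + SS a n (m - 1) (l + 1) +
        SS a n (m + 1) (l - 1) + SS a n (m + 1) (l + 1)) := by
  have key : ∀ b b' : Bool, (∑ s : Fin n → Bool, ∑ t : Fin n → Bool,
      if Adm (Fin.snoc (α := fun _ => Bool) s b : Fin (n + 1) → Bool)
        (Fin.snoc (α := fun _ => Bool) t b' : Fin (n + 1) → Bool) m l
      then a ^ visits 0 (Fin.snoc (α := fun _ => Bool) s b : Fin (n + 1) → Bool) else 0) =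
      (if m = 0 then a else 1) * SS a n (m - sgn b) (l - sgn b') := by
    intro b b'
    unfold SS
    rw [Finset.mul_sum]
    apply Finset.sum_congr rfl
    intro s _
    rw [Finset.mul_sum]
    apply Finset.sum_congr rfl
    intro t _
    rw [visits_snoc]
    by_cases h : Adm s t (m - sgn b) (l - sgn b')
    · rw [if_pos ((adm_snoc s t b b' m l hm hl).2 h), if_pos h]
      have h4 : hgt 0 s n + sgn b = m := by
        have := h.2.2.2.1
        omega
      rw [h4]
      split_ifs with h0
      · rw [pow_succ, mul_comm]
      · simp
    · rw [if_neg (fun h' => h ((adm_snoc s t b b' m l hm hl).1 h')), if_neg h, mul_zero]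
  have : SS a (n + 1) m l = ∑ b : Bool, ∑ b' : Bool, ∑ s : Fin n → Bool, ∑ t : Fin n → Bool,
      if Adm (Fin.snoc (α := fun _ => Bool) s b : Fin (n + 1) → Bool)
        (Fin.snoc (α := fun _ => Bool) t b' : Fin (n + 1) → Bool) m l
      then a ^ visits 0 (Fin.snoc (α := fun _ => Bool) s b : Fin (n + 1) → Bool) else 0 := by
    unfold SS
    rw [sum_snoc]
    apply Finset.sum_congr rfl
    intro b _
    rw [Finset.sum_comm]
    rw [Finset.sum_comm]
    simp_rw [sum_snoc (n := n)]
    rw [Finset.sum_comm]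
  rw [this]
  simp_rw [key]
  generalize (if m = 0 then a else 1) = w
  simp only [Fintype.sum_bool, sgn]
  simp
  ring

/-- free evolution on the integers -/
noncomputable def ev (f : ℤ → ℝ) : ℕ → ℤ → ℝ
  | 0 => f
  | n + 1 => fun x => ev f n (x - 1) + ev f n (x + 1)

lemma ev_succ (f : ℤ → ℝ) (n : ℕ) (x : ℤ) :
    ev f (n + 1) x = ev f n (x - 1) + ev f n (x + 1) := rfl

lemma ev_bound (f : ℤ → ℝ) (C t : ℝ) (ht : 0 < t) (h : ∀ x, |f x| ≤ C * t ^ x) (n : ℕ) (x : ℤ) :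
    |ev f n x| ≤ C * (t + t⁻¹) ^ n * t ^ x := by
  induction n generalizing x with
  | zero => simpa [ev] using h x
  | succ n ih =>
    rw [ev_succ]
    calc |ev f n (x - 1) + ev f n (x + 1)| ≤ |ev f n (x - 1)| + |ev f n (x + 1)| := abs_add_le _ _
      _ ≤ C * (t + t⁻¹) ^ n * t ^ (x - 1) + C * (t + t⁻¹) ^ n * t ^ (x + 1) := add_le_add (ih _) (ih _)
      _ = _ := by
        rw [zpow_sub_one₀ ht.ne', zpow_add_one₀ ht.ne', pow_succ]; ring

lemma ev_parity (f : ℤ → ℝ) (h : ∀ x, ¬ Even x → f x = 0) (n : ℕ) (x : ℤ)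
    (hx : ¬ Even (x + n)) : ev f n x = 0 := by
  induction n generalizing x with
  | zero => exact h x (by simpa using hx)
  | succ n ih =>
    rw [ev_succ, ih, ih, add_zero]
    · intro h; apply hx; push_cast; convert h using 1; ring
    · intro h; apply hx; push_cast
      have := h.add (even_two (α := ℤ))
      rwa [show x - 1 + (n : ℤ) + 2 = x + (n + 1) by ring] at this

/-- boundary condition -/
def BC (a : ℝ) (f : ℤ → ℝ) : Prop :=
  ∀ l, f (-l - 1) - (a - 1) * f (-l + 1) = - f (l - 1) + (a - 1) * f (l + 1)

lemma ev_BC (a : ℝ) (f : ℤ → ℝ) (h : BC a f) (n : ℕ) : BC a (ev f n) := by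
  induction n with
  | zero => exact h
  | succ n ih =>
    intro l
    simp only [ev_succ]
    have h1 := ih (l + 1)
    have h2 := ih (l - 1)
    rw [show -(l + 1) - 1 = -l - 1 - 1 by ring, show -(l + 1) + 1 = -l - 1 + 1 by ring,
      show l + 1 - 1 = l by ring] at h1
    rw [show -(l - 1) - 1 = -l + 1 - 1 by ring, show -(l - 1) + 1 = -l + 1 + 1 by ring,
      show l - 1 + 1 = l by ring] at h2
    rw [show -l + 1 - 1 = -l - 1 + 1 by ring] at h2 ⊢
    rw [show l + 1 - 1 = l by ring, show l - 1 + 1 = l by ring]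
    linarith

lemma ev_zero_bdry (a : ℝ) (f : ℤ → ℝ) (h : BC a f) (n : ℕ) : ev f (n + 1) 0 = a * ev f n 1 := by
  have := ev_BC a f h n 0
  rw [ev_succ]
  norm_num at this ⊢
  linarith

lemma SS_det (a : ℝ) (f g : ℤ → ℝ) (hf : BC a f) (hg : BC a g)
    (hpf : ∀ x, ¬ Even x → f x = 0) (hpg : ∀ x, ¬ Even x → g x = 0)
    (h0 : ∀ m l : ℤ, 0 ≤ m → m < l → SS a 0 m l = f m * g l - f l * g m) (n : ℕ) :
    ∀ m l : ℤ, 0 ≤ m → m < l →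
      SS a n m l = ev f n m * ev g n l - ev f n l * ev g n m := by
  induction n with
  | zero => exact h0
  | succ n ih =>
    intro m l hm hl
    have ih' : ∀ m l : ℤ, 0 ≤ m → m ≤ l + 1 →
        SS a n m l = ev f n m * ev g n l - ev f n l * ev g n m := by
      intro m l hm hl
      rcases lt_trichotomy m l with h | h | h
      · exact ih m l hm h
      · subst h
        rw [SS_eq_zero _ _ _ _ (Or.inr le_rfl)]; ring
      · obtain rfl : m = l + 1 := by omega
        rw [SS_eq_zero _ _ _ _ (Or.inr (by omega))]
        by_cases hp : Even (l + n)
        · have : ¬ Even (l + 1 + n) := by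
            intro h
            have := h.sub hp
            ring_nf at this
            exact absurd this (by decide)
          rw [ev_parity f hpf n _ this, ev_parity g hpg n _ this]; ring
        · rw [ev_parity f hpf n _ hp, ev_parity g hpg n _ hp]; ring
    rw [SS_succ a n m l hm hl]
    rcases hm.eq_or_lt with h | h
    · subst h
      rw [if_pos rfl, SS_eq_zero a n (0 - 1) _ (Or.inl (by norm_num)),
        SS_eq_zero a n (0 - 1) _ (Or.inl (by norm_num)), ih' _ _ (by norm_num) (by omega),
        ih' _ _ (by norm_num) (by omega), ev_zero_bdry a f hf, ev_zero_bdry a g hg,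
        ev_succ, ev_succ]
      simp only [zero_add]
      ring
    · rw [if_neg h.ne', ih' _ _ (by omega) (by omega), ih' _ _ (by omega) (by omega),
        ih' _ _ (by omega) (by omega), ih' _ _ (by omega) (by omega)]
      simp only [ev_succ]
      ring

/-- extended initial condition for lower path -/
noncomputable def U0 (a lam : ℝ) (x : ℤ) : ℝ :=
  if Even x then (if x < 0 then a * (a - 2) / (a - 1) * lam ^ x else if x = 0 then a else 0) else 0

/-- extended initial condition for upper path -/
noncomputable def V0 (a : ℝ) (x : ℤ) : ℝ :=
  if x = 2 then 1 else if x = 0 then - (a / (a - 1)) else if x = -2 then 1 / (a - 1) else 0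

lemma V0_par (a : ℝ) (x : ℤ) (hx : ¬ Even x) : V0 a x = 0 := by
  unfold V0
  rw [if_neg, if_neg, if_neg]
  all_goals (rintro rfl; exact hx (by decide))

lemma U0_par (a lam : ℝ) (x : ℤ) (hx : ¬ Even x) : U0 a lam x = 0 := by
  unfold U0
  rw [if_neg hx]

lemma V0_BC (a : ℝ) (ha : 2 < a) : BC a (V0 a) := by
  have h1 : a - 1 ≠ 0 := by linarith
  have key : ∀ l : ℤ, 0 ≤ l →
      V0 a (-l - 1) - (a - 1) * V0 a (-l + 1) = - V0 a (l - 1) + (a - 1) * V0 a (l + 1) := by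
    intro l hl
    by_cases e1 : l = 1
    · subst e1; simp [V0]; field_simp; ring
    by_cases e2 : l = 3
    · subst e2; simp [V0]; field_simp; try ring
    have : V0 a (-l - 1) = 0 := by
      unfold V0; rw [if_neg (by omega), if_neg (by omega), if_neg (by omega)]
    have h2 : V0 a (-l + 1) = 0 := by
      unfold V0; rw [if_neg (by omega), if_neg (by omega), if_neg (by omega)]
    have h3 : V0 a (l - 1) = 0 := by
      unfold V0; rw [if_neg (by omega), if_neg (by omega), if_neg (by omega)]
    have h4 : V0 a (l + 1) = 0 := by
      unfold V0; rw [if_neg (by omega), if_neg (by omega), if_neg (by omega)]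
    rw [this, h2, h3, h4]; ring
  intro l
  rcases le_total 0 l with h | h
  · exact key l h
  · have := key (-l) (by omega)
    rw [neg_neg] at this
    linarith

lemma U0_BC (a lam : ℝ) (ha : 2 < a) (hlam : 0 < lam) (hl2 : lam ^ 2 * (a - 1) = 1) :
    BC a (U0 a lam) := by
  have h1 : a - 1 ≠ 0 := by linarith
  have key : ∀ l : ℤ, 0 ≤ l →
      U0 a lam (-l - 1) - (a - 1) * U0 a lam (-l + 1) =
        - U0 a lam (l - 1) + (a - 1) * U0 a lam (l + 1) := by
    intro l hl
    by_cases hp : Even (l + 1)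
    swap
    · rw [U0_par, U0_par, U0_par, U0_par]
      · ring
      · exact hp
      · intro h; apply hp; have := h.add even_two; ring_nf at this; rwa [add_comm] at this
      · intro h; apply hp; have := (h.neg).add even_two; ring_nf at this; rwa [add_comm] at this
      · intro h; apply hp; have := h.neg; ring_nf at this; rwa [add_comm] at this
    have hp2 : Even (-l - 1) := by have := hp.neg; rwa [neg_add'] at this
    have hp3 : Even (-l + 1) := by
      have := hp2.add even_two; ring_nf at this; rwa [neg_add_eq_sub]
    have hp4 : Even (l - 1) := by have := hp3.neg; ring_nf at this; rwa [sub_eq_neg_add]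
    unfold U0
    rw [if_pos hp, if_pos hp2, if_pos hp3, if_pos hp4]
    by_cases e1 : l = 1
    · subst e1
      have : lam ^ (-2 : ℤ) = a - 1 := by
        rw [zpow_neg]
        have : lam ^ (2 : ℤ) = lam ^ 2 := by norm_cast
        rw [this]
        field_simp
        linarith
      norm_num [this]
      field_simp
      ring
    · have : l ≠ 0 := by rintro rfl; exact absurd hp (by decide)
      rw [if_pos (by omega), if_pos (by omega), if_neg (by omega), if_neg (by omega),
        if_neg (by omega), if_neg (by omega)]
      have : lam ^ (-l + 1) = lam ^ (-l - 1) * lam ^ 2 := by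
        rw [← zpow_natCast, ← zpow_add₀ hlam.ne']; congr 1; push_cast; ring
      rw [this]
      linear_combination (- a * (a - 2) / (a - 1) * lam ^ (-l - 1)) * hl2
  intro l
  rcases le_total 0 l with h | h
  · exact key l h
  · have := key (-l) (by omega)
    rw [neg_neg] at this
    linarith

lemma SS_base (a lam : ℝ) (m l : ℤ) (hm : 0 ≤ m) (hl : m < l) :
    SS a 0 m l = U0 a lam m * V0 a l - U0 a lam l * V0 a m := by
  have hU : U0 a lam l = 0 := by
    unfold U0; split_ifs <;> first | rfl | omega
  have hU' : U0 a lam m = if m = 0 then a else 0 := by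
    unfold U0
    split_ifs with h1 h2 h3 h4 h5 <;> first | rfl | omega | skip
    · subst h5; exact absurd h1 (by decide)
  rw [hU, hU']
  have : SS a 0 m l = if m = 0 ∧ l = 2 then a else 0 := by
    unfold SS Adm InUHP visits
    simp [hgt]
    congr 1
    apply propext
    constructor
    · rintro ⟨rfl, rfl⟩; simp
    · rintro ⟨rfl, rfl⟩; simp
  rw [this]
  split_ifs with h1 h2 h2
  · simp [V0, h1.2]
  · exact absurd h1.1 h2
  · subst h2
    have : l ≠ 2 := by tauto
    unfold V0
    rw [if_neg this, if_neg (by omega), if_neg (by omega)]; ring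
  · ring

lemma sW_det (a lam : ℝ) (ha : 2 < a) (hlam : 0 < lam) (hl2 : lam ^ 2 * (a - 1) = 1)
    (n k m : ℕ) (hmk : m ≤ k) :
    sW a n k m = ev (U0 a lam) n m * ev (V0 a) n ((k + 2 : ℕ) : ℤ)
      - ev (U0 a lam) n ((k + 2 : ℕ) : ℤ) * ev (V0 a) n m := by
  rw [sW_eq_SS, SS_det a (U0 a lam) (V0 a) (U0_BC a lam ha hlam hl2) (V0_BC a ha) (U0_par a lam)
    (V0_par a) (SS_base a lam) n _ _ (by omega) (by omega)]
  push_cast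
  rfl


open MeasureTheory in
lemma laplace (W : ℝ → ℝ) (hW : Continuous W) (κ : ℝ) (h0 : 0 < κ) (h1 : κ ≤ 1) :
    Tendsto (fun N : ℕ => Real.sqrt N *
        ∫ θ in (-Real.pi)..Real.pi, (1 - κ * Real.sin (θ / 2) ^ 2) ^ N * W θ) atTop
      (nhds (W 0 * Real.sqrt (Real.pi / (κ / 4)))) := by
  have hpi := Real.pi_pos
  obtain ⟨C, hC⟩ : ∃ C, ∀ θ ∈ Set.Icc (-Real.pi) Real.pi, ‖W θ‖ ≤ C :=
    isCompact_Icc.exists_bound_of_continuousOn hW.continuousOn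
  let F : ℕ → ℝ → ℝ := fun N s => (Set.Ioc (-Real.pi * Real.sqrt N) (Real.pi * Real.sqrt N)).indicator
    (fun s => (1 - κ * Real.sin (s / Real.sqrt N / 2) ^ 2) ^ N * W (s / Real.sqrt N)) s
  have hF : ∀ N : ℕ, 0 < N → Real.sqrt N *
        ∫ θ in (-Real.pi)..Real.pi, (1 - κ * Real.sin (θ / 2) ^ 2) ^ N * W θ = ∫ s, F N s := by
    intro N hN
    have hs : 0 < Real.sqrt N := Real.sqrt_pos.2 (by exact_mod_cast hN)
    have := intervalIntegral.integral_comp_div (a := -Real.pi * Real.sqrt N)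
      (b := Real.pi * Real.sqrt N)
      (fun θ => (1 - κ * Real.sin (θ / 2) ^ 2) ^ N * W θ) hs.ne'
    rw [mul_div_cancel_right₀ _ hs.ne', mul_div_cancel_right₀ _ hs.ne', smul_eq_mul] at this
    rw [← this, intervalIntegral.integral_of_le (by nlinarith)]
    rw [← integral_indicator measurableSet_Ioc]
  have hlim : Tendsto (fun N => ∫ s, F N s) atTop
      (nhds (∫ s, Real.exp (-(κ / 4) * s ^ 2) * W 0)) := by
    apply tendsto_integral_of_dominated_convergence
      (fun s => Real.exp (-(κ / Real.pi ^ 2) * s ^ 2) * C)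
    · intro N
      apply Measurable.aestronglyMeasurable
      apply Measurable.indicator _ measurableSet_Ioc
      apply Continuous.measurable
      fun_prop
    · exact (integrable_exp_neg_mul_sq (by positivity)).mul_const C
    · intro N
      refine Filter.Eventually.of_forall fun s => ?_
      have hC0 : 0 ≤ C := (norm_nonneg _).trans (hC 0 ⟨by linarith, by linarith⟩)
      by_cases hs : s ∈ Set.Ioc (-Real.pi * Real.sqrt N) (Real.pi * Real.sqrt N)
      swap
      · simp only [F]; rw [Set.indicator_of_notMem hs, norm_zero]; positivity
      simp only [F]
      rw [Set.indicator_of_mem hs, norm_mul]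
      have hN : 0 < Real.sqrt N := by
        rcases (Real.sqrt_nonneg (N : ℝ)).eq_or_lt with h | h
        · rw [← h] at hs; simp at hs
        · exact h
      have hN2 : Real.sqrt N ^ 2 = N := Real.sq_sqrt (by positivity)
      set θ := s / Real.sqrt N with hθ
      have hsθ : s = θ * Real.sqrt N := by rw [hθ]; field_simp
      have hθ1 : -Real.pi ≤ θ := by
        rw [hθ, le_div_iff₀ hN]; exact hs.1.le
      have hθ2 : θ ≤ Real.pi := by
        rw [hθ, div_le_iff₀ hN]; exact hs.2
      have hsin : (θ / Real.pi) ^ 2 ≤ Real.sin (θ / 2) ^ 2 := by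
        have h := Real.mul_abs_le_abs_sin (x := θ / 2) (by rw [abs_le]; constructor <;> linarith)
        rw [← sq_abs (Real.sin (θ / 2))]
        have h3 : 2 / Real.pi * |θ / 2| = |θ / Real.pi| := by
          rw [abs_div θ 2, abs_div θ Real.pi, abs_two, abs_of_pos hpi]; field_simp
        rw [h3] at h
        rw [← sq_abs (θ / Real.pi)]
        exact pow_le_pow_left₀ (abs_nonneg _) h 2
      have hle : Real.sin (θ / 2) ^ 2 ≤ 1 := Real.sin_sq_le_one _
      have hb0 : 0 ≤ 1 - κ * Real.sin (θ / 2) ^ 2 := by nlinarith [sq_nonneg (Real.sin (θ / 2))]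
      gcongr
      · rw [Real.norm_eq_abs, abs_of_nonneg (pow_nonneg hb0 N)]
        calc (1 - κ * Real.sin (θ / 2) ^ 2) ^ N
            ≤ (Real.exp (-(κ * (θ / Real.pi) ^ 2))) ^ N := by
              apply pow_le_pow_left₀ hb0
              have := Real.add_one_le_exp (-(κ * (θ / Real.pi) ^ 2))
              nlinarith
          _ = _ := by
              rw [← Real.exp_nat_mul]
              congr 1
              rw [hsθ, mul_pow, hN2]
              field_simp
      · exact hC _ ⟨hθ1, hθ2⟩
    · refine Filter.Eventually.of_forall fun s => ?_
      have hsq : Tendsto (fun N : ℕ => Real.sqrt N) atTop atTop :=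
        Real.tendsto_sqrt_atTop.comp tendsto_natCast_atTop_atTop
      have hz : Tendsto (fun N : ℕ => s / Real.sqrt N) atTop (nhds 0) :=
        tendsto_const_nhds.div_atTop hsq
      have hz2 : Tendsto (fun N : ℕ => s / Real.sqrt N / 2) atTop (nhds 0) := by
        simpa using hz.div_const 2
      have hsinc : Tendsto (fun N : ℕ => Real.sinc (s / Real.sqrt N / 2)) atTop (nhds 1) := by
        have := (Real.continuous_sinc.tendsto 0).comp hz2
        rw [Real.sinc_zero] at this
        exact this
      have hg : Tendsto (fun N : ℕ => (N : ℝ) * (- (κ * Real.sin (s / Real.sqrt N / 2) ^ 2))) atTop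
          (nhds (-(κ / 4) * s ^ 2)) := by
        have h3 : Tendsto (fun N : ℕ => -(κ / 4) * s ^ 2 *
            (Real.sinc (s / Real.sqrt N / 2)) ^ 2) atTop (nhds (-(κ / 4) * s ^ 2 * 1 ^ 2)) :=
          (hsinc.pow 2).const_mul _
        rw [one_pow, mul_one] at h3
        refine h3.congr' ?_
        filter_upwards [eventually_gt_atTop 0] with N hN
        have hs : 0 < Real.sqrt N := Real.sqrt_pos.2 (by exact_mod_cast hN)
        have hN2 : Real.sqrt N ^ 2 = N := Real.sq_sqrt (by positivity)
        have : Real.sin (s / Real.sqrt N / 2) =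
            (s / Real.sqrt N / 2) * Real.sinc (s / Real.sqrt N / 2) := by
          by_cases hx : s / Real.sqrt N / 2 = 0
          · rw [hx]; simp
          · rw [Real.sinc_of_ne_zero hx, mul_div_cancel₀ _ hx]
        rw [this]
        generalize Real.sinc (s / Real.sqrt N / 2) = z
        rw [← hN2]
        rw [show Real.sqrt (Real.sqrt N ^ 2) = Real.sqrt N by rw [hN2]]
        field_simp
        ring
      have hpow := Real.tendsto_one_add_pow_exp_of_tendsto hg
      have hWl : Tendsto (fun N : ℕ => W (s / Real.sqrt N)) atTop (nhds (W 0)) :=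
        (hW.tendsto 0).comp hz
      refine (hpow.mul hWl).congr' ?_
      have hev : ∀ᶠ N : ℕ in atTop, |s| < Real.pi * Real.sqrt N := by
        have := (hsq.const_mul_atTop hpi).eventually_gt_atTop |s|
        exact this
      filter_upwards [hev] with N hN
      simp only [F]
      rw [abs_lt] at hN
      rw [Set.indicator_of_mem (Set.mem_Ioc.2 ⟨by linarith [hN.1], hN.2.le⟩)]
      ring
  rw [integral_mul_const, integral_gaussian, mul_comm] at hlim
  refine hlim.congr' ?_
  filter_upwards [eventually_gt_atTop 0] with N hN
  exact (hF N hN).symm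

lemma int_cos (d : ℤ) : ∫ θ in (-Real.pi)..Real.pi, Real.cos (d * θ) =
    if d = 0 then 2 * Real.pi else 0 := by
  split_ifs with h
  · subst h; simp; ring
  · have hd : (d : ℝ) ≠ 0 := by exact_mod_cast h
    rw [intervalIntegral.integral_comp_mul_left (fun x => Real.cos x) hd]
    simp [Real.sin_int_mul_pi]

/-- the Fourier weight -/
noncomputable def WW (a y θ : ℝ) : ℝ :=
  (y ^ 2 + (a / (a - 1)) ^ 2 + (1 / (a - 1)) ^ 2 / y ^ 2)
    + 2 * (-(y * (a / (a - 1))) - (a / (a - 1)) * (1 / (a - 1)) / y) * Real.cos θ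
    + 2 * (1 / (a - 1)) * Real.cos (2 * θ)

/-- the Fourier integral -/
noncomputable def JJ (a y : ℝ) (N : ℕ) (d : ℤ) : ℝ :=
  (2 * Real.pi)⁻¹ * ∫ θ in (-Real.pi)..Real.pi,
    (y + y⁻¹ + 2 * Real.cos θ) ^ N * WW a y θ * Real.cos (d * θ)

lemma WW_cont (a y : ℝ) : Continuous (WW a y) := by
  unfold WW; fun_prop

lemma JJ_succ (a y : ℝ) (N : ℕ) (d : ℤ) :
    JJ a y (N + 1) d = (y + y⁻¹) * JJ a y N d + JJ a y N (d + 1) + JJ a y N (d - 1) := by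
  unfold JJ
  have hc := WW_cont a y
  have hi : ∀ d : ℤ, IntervalIntegrable (fun θ : ℝ => (y + y⁻¹ + 2 * Real.cos θ) ^ N * WW a y θ *
      Real.cos (d * θ)) MeasureTheory.volume (-Real.pi) Real.pi := by
    intro d
    apply Continuous.intervalIntegrable
    fun_prop
  rw [mul_left_comm, ← mul_add, ← mul_add, ← intervalIntegral.integral_const_mul (y + y⁻¹),
    ← intervalIntegral.integral_add ((hi d).const_mul _) (hi _),
    ← intervalIntegral.integral_add (((hi d).const_mul _).add (hi _)) (hi _)]
  congr 1
  apply intervalIntegral.integral_congr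
  intro θ _
  simp only
  push_cast
  rw [add_mul (d : ℝ) 1 θ, sub_mul (d : ℝ) 1 θ, Real.cos_add, Real.cos_sub, pow_succ]
  ring

lemma JJ_zero (a y : ℝ) (d : ℤ) :
    JJ a y 0 d = (y ^ 2 + (a / (a - 1)) ^ 2 + (1 / (a - 1)) ^ 2 / y ^ 2) * (if d = 0 then 1 else 0)
    + (-(y * (a / (a - 1))) - (a / (a - 1)) * (1 / (a - 1)) / y) *
      ((if d + 1 = 0 then 1 else 0) + (if d - 1 = 0 then 1 else 0))
    + (1 / (a - 1)) * ((if d + 2 = 0 then 1 else 0) + (if d - 2 = 0 then 1 else 0)) := by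
  unfold JJ
  have hpi := Real.pi_pos
  have hi : ∀ d : ℤ, ∀ c : ℝ, IntervalIntegrable (fun θ : ℝ => c * Real.cos (d * θ))
      MeasureTheory.volume (-Real.pi) Real.pi := by
    intro d c
    apply Continuous.intervalIntegrable
    fun_prop
  set q0 := (y ^ 2 + (a / (a - 1)) ^ 2 + (1 / (a - 1)) ^ 2 / y ^ 2)
  set q1 := (-(y * (a / (a - 1))) - (a / (a - 1)) * (1 / (a - 1)) / y)
  set q2 := (1 / (a - 1))
  have : ∀ θ : ℝ, (y + y⁻¹ + 2 * Real.cos θ) ^ 0 * WW a y θ * Real.cos (d * θ) =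
      q0 * Real.cos (d * θ) + q1 * Real.cos ((d + 1 : ℤ) * θ) + q1 * Real.cos ((d - 1 : ℤ) * θ)
      + q2 * Real.cos ((d + 2 : ℤ) * θ) + q2 * Real.cos ((d - 2 : ℤ) * θ) := by
    intro θ
    push_cast
    rw [add_mul (d : ℝ) 1 θ, sub_mul (d : ℝ) 1 θ, add_mul (d : ℝ) 2 θ, sub_mul (d : ℝ) 2 θ,
      Real.cos_add, Real.cos_sub, Real.cos_add, Real.cos_sub]
    simp only [WW, q0, q1, q2]
    ring
  simp_rw [this]
  rw [intervalIntegral.integral_add (((((hi _ _).add (hi _ _)).add (hi _ _)).add (hi _ _))) (hi _ _),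
    intervalIntegral.integral_add ((((hi _ _).add (hi _ _)).add (hi _ _))) (hi _ _),
    intervalIntegral.integral_add (((hi _ _).add (hi _ _))) (hi _ _),
    intervalIntegral.integral_add (hi _ _) (hi _ _)]
  simp only [intervalIntegral.integral_const_mul, int_cos]
  split_ifs <;> field_simp <;> ring

lemma parseval (a y : ℝ) (hy : 0 < y) (N : ℕ) : ∀ d : ℤ,
    HasSum (fun x : ℤ => ev (V0 a) N x * ev (V0 a) N (x + 2 * d) * y ^ (x + d)) (JJ a y N d) := by
  induction N with
  | zero =>
    intro d
    have h0 : ∀ x ∉ ({-2, 0, 2} : Finset ℤ), V0 a x = 0 := by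
      intro x hx
      simp at hx
      unfold V0; rw [if_neg (by tauto), if_neg (by tauto), if_neg (by tauto)]
    have := hasSum_sum_of_ne_finset_zero (L := SummationFilter.unconditional ℤ) (s := ({-2, 0, 2} : Finset ℤ))
      (f := fun x : ℤ => V0 a x * V0 a (x + 2 * d) * y ^ (x + d)) (by
        intro x hx
        rw [h0 x hx]; ring)
    suffices hE : JJ a y 0 d = _ from hE ▸ this
    rw [JJ_zero]
    rw [Finset.sum_insert (by decide), Finset.sum_insert (by decide), Finset.sum_singleton]
    by_cases e0 : d = 0
    · subst e0
      simp [V0, zpow_neg]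
      norm_cast
      field_simp
      ring
    by_cases e1 : d = 1
    · subst e1
      simp [V0]
      field_simp
      ring
    by_cases e2 : d = -1
    · subst e2
      simp [V0]
      field_simp
      ring
    by_cases e3 : d = 2
    · subst e3
      simp [V0]
    by_cases e4 : d = -2
    · subst e4
      simp [V0]
    rw [if_neg e0, if_neg (by omega), if_neg (by omega), if_neg (by omega), if_neg (by omega)]
    rw [h0 (-2 + 2 * d) (by simp; omega)]
    by_cases e5 : d = 1 ∨ d = -1
    · omega
    rw [h0 (0 + 2 * d) (by simp; omega), h0 (2 + 2 * d) (by simp; omega)]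
    ring
  | succ N ih =>
    intro d
    rw [JJ_succ]
    have hs : ∀ d, HasSum (fun x : ℤ => ev (V0 a) N (x - 1) * ev (V0 a) N (x - 1 + 2 * d) *
        y ^ (x - 1 + d)) (JJ a y N d) := fun d =>
      (Equiv.hasSum_iff (Equiv.subRight (1 : ℤ))
        (f := fun x : ℤ => ev (V0 a) N x * ev (V0 a) N (x + 2 * d) * y ^ (x + d))).2 (ih d)
    have hs' : ∀ d, HasSum (fun x : ℤ => ev (V0 a) N (x + 1) * ev (V0 a) N (x + 1 + 2 * d) *
        y ^ (x + 1 + d)) (JJ a y N d) := fun d =>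
      (Equiv.hasSum_iff (Equiv.addRight (1 : ℤ))
        (f := fun x : ℤ => ev (V0 a) N x * ev (V0 a) N (x + 2 * d) * y ^ (x + d))).2 (ih d)
    have := ((((hs d).mul_left y).add ((hs' d).mul_left y⁻¹)).add (hs (d + 1))).add (hs' (d - 1))
    have hR : (y + y⁻¹) * JJ a y N d + JJ a y N (d + 1) + JJ a y N (d - 1) =
        y * JJ a y N d + y⁻¹ * JJ a y N d + JJ a y N (d + 1) + JJ a y N (d - 1) := by ring
    rw [hR]
    refine (funext ?_ : (fun x : ℤ => ev (V0 a) (N + 1) x * ev (V0 a) (N + 1) (x + 2 * d) *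
      y ^ (x + d)) = _) ▸ this
    · intro x
      simp only [ev_succ]
      rw [show x + 2 * d - 1 = x - 1 + 2 * d by ring, show x + 2 * d + 1 = x + 1 + 2 * d by ring,
        show x - 1 + 2 * (d + 1) = x + 1 + 2 * d by ring,
        show x + 1 + 2 * (d - 1) = x - 1 + 2 * d by ring,
        show x - 1 + d = x + d - 1 by ring, show x + 1 + d = x + d + 1 by ring,
        show x - 1 + (d + 1) = x + d by ring, show x + 1 + (d - 1) = x + d by ring,
        zpow_sub_one₀ hy.ne', zpow_add_one₀ hy.ne']
      field_simp
      ring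

lemma JJ_asymp (a y : ℝ) (hA : a - 1 ≠ 0) (hy : 0 < y) :
    Tendsto (fun N : ℕ => JJ a y N 0 / (((1 + y) ^ 2 / y) ^ N / Real.sqrt N)) atTop
      (nhds ((y - a / (a - 1) + 1 / (a - 1) / y) ^ 2 * ((1 + y) / (2 * Real.sqrt (Real.pi * y))))) := by
  have hpi := Real.pi_pos
  have hκ : 4 * y / (1 + y) ^ 2 ≤ 1 := by
    rw [div_le_one (by positivity)]; nlinarith [sq_nonneg (1 - y)]
  have h := (laplace (WW a y) (WW_cont a y) (4 * y / (1 + y) ^ 2) (by positivity) hκ).const_mul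
    (2 * Real.pi)⁻¹
  have hlim : (2 * Real.pi)⁻¹ * (WW a y 0 * Real.sqrt (Real.pi / (4 * y / (1 + y) ^ 2 / 4))) =
      (y - a / (a - 1) + 1 / (a - 1) / y) ^ 2 * ((1 + y) / (2 * Real.sqrt (Real.pi * y))) := by
    have e1 : WW a y 0 = (y - a / (a - 1) + 1 / (a - 1) / y) ^ 2 := by
      unfold WW
      simp only [mul_zero, Real.cos_zero]
      field_simp
      ring
    have e2 : Real.sqrt (Real.pi / (4 * y / (1 + y) ^ 2 / 4)) =
        Real.pi * (1 + y) / Real.sqrt (Real.pi * y) := by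
      have : Real.pi / (4 * y / (1 + y) ^ 2 / 4) = (Real.pi * (1 + y)) ^ 2 / (Real.pi * y) := by
        field_simp
      rw [this, Real.sqrt_div (by positivity), Real.sqrt_sq (by positivity)]
    rw [e1, e2]
    field_simp
  rw [hlim] at h
  refine h.congr fun N => ?_
  unfold JJ
  have : ∀ θ : ℝ, (y + y⁻¹ + 2 * Real.cos θ) ^ N * WW a y θ * Real.cos ((0 : ℤ) * θ) =
      ((1 + y) ^ 2 / y) ^ N *
        ((1 - 4 * y / (1 + y) ^ 2 * Real.sin (θ / 2) ^ 2) ^ N * WW a y θ) := by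
    intro θ
    rw [← mul_assoc, ← mul_pow]
    have : Real.cos θ = 1 - 2 * Real.sin (θ / 2) ^ 2 := by
      have := Real.cos_two_mul (θ / 2)
      rw [mul_div_cancel₀ θ (two_ne_zero)] at this
      have h2 := Real.sin_sq_add_cos_sq (θ / 2)
      linarith
    rw [this]
    have : y + y⁻¹ + 2 * (1 - 2 * Real.sin (θ / 2) ^ 2) =
      (1 + y) ^ 2 / y * (1 - 4 * y / (1 + y) ^ 2 * Real.sin (θ / 2) ^ 2) := by
      field_simp
      ring
    rw [this]
    simp
  simp_rw [this]
  rw [intervalIntegral.integral_const_mul]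
  have : ((1 + y) ^ 2 / y) ^ N ≠ 0 := by positivity
  rcases Nat.eq_zero_or_pos N with h0 | h0
  · subst h0; simp
  · have : Real.sqrt N ≠ 0 := (Real.sqrt_pos.2 (by exact_mod_cast h0)).ne'
    generalize ((1 + y) ^ 2 / y) ^ N = B at *
    field_simp


lemma polygeo (q : ℝ) (h0 : 0 < q) (h1 : q < 1) :
    Tendsto (fun N : ℕ => ((N : ℝ) + 1) ^ 3 * q ^ N) atTop (nhds 0) := by
  have h := tendsto_pow_const_mul_const_pow_of_abs_lt_one 3 (r := q) (by rw [abs_of_pos h0]; exact h1)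
  have h2 := ((tendsto_add_atTop_iff_nat 1).2 h).div_const q
  rw [zero_div] at h2
  refine h2.congr fun N => ?_
  push_cast
  rw [pow_succ q N]
  field_simp

lemma ev_add (f g : ℤ → ℝ) (n : ℕ) (x : ℤ) :
    ev (fun x => f x + g x) n x = ev f n x + ev g n x := by
  induction n generalizing x with
  | zero => rfl
  | succ n ih => rw [ev_succ, ev_succ, ev_succ, ih, ih]; ring

lemma ev_eig (c lam : ℝ) (hlam : 0 < lam) (n : ℕ) (x : ℤ) :
    ev (fun x => if Even x then c * lam ^ x else 0) n x =
      if Even (x + n) then c * (lam + lam⁻¹) ^ n * lam ^ x else 0 := by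
  induction n generalizing x with
  | zero => simp [ev]
  | succ n ih =>
    rw [ev_succ, ih, ih]
    have e1 : Even (x - 1 + n) ↔ Even (x + (n + 1 : ℕ)) := by
      push_cast
      rw [show x + ((n : ℤ) + 1) = x - 1 + n + 2 by ring]
      simp [Int.even_add]
    have e2 : Even (x + 1 + n) ↔ Even (x + (n + 1 : ℕ)) := by
      push_cast
      rw [show x + ((n : ℤ) + 1) = x + 1 + n by ring]
    simp only [e1, e2]
    split_ifs
    · rw [zpow_sub_one₀ hlam.ne', zpow_add_one₀ hlam.ne', pow_succ]; ring
    · ring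

lemma V_bound (a : ℝ) : ∃ C, 0 < C ∧ ∀ (N : ℕ) (x : ℤ), |ev (V0 a) N x| ≤ C * 2 ^ N := by
  refine ⟨1 + |a / (a - 1)| + |1 / (a - 1)|, by positivity, fun N x => ?_⟩
  have := ev_bound (V0 a) (1 + |a / (a - 1)| + |1 / (a - 1)|) 1 one_pos (by
    intro x
    rw [one_zpow, mul_one]
    have h1 := abs_nonneg (a / (a - 1))
    have h2 := abs_nonneg (1 / (a - 1))
    unfold V0
    split_ifs
    · rw [abs_one]; linarith
    · rw [abs_neg]; linarith
    · linarith
    · rw [abs_zero]; linarith) N x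
  norm_num at this
  norm_num
  exact this

lemma V_supp (a : ℝ) (N : ℕ) (x : ℤ) (hx : (N : ℤ) + 2 < |x|) : ev (V0 a) N x = 0 := by
  induction N generalizing x with
  | zero =>
    show V0 a x = 0
    unfold V0
    rw [if_neg, if_neg, if_neg]
    all_goals (rintro rfl; norm_num at hx)
  | succ N ih =>
    rw [ev_succ, ih, ih, add_zero]
    all_goals
      push_cast at hx
      rw [lt_abs] at hx ⊢
      omega

lemma U_bound (a lam t : ℝ) (ha : 2 < a) (ht : 0 < t) (htl : t ≤ lam) (N : ℕ) (x : ℤ) :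
    |ev (U0 a lam) N x| ≤ a * (t + t⁻¹) ^ N * t ^ x := by
  have hlam : 0 < lam := ht.trans_le htl
  apply ev_bound _ _ _ ht
  intro x
  have hc0 : 0 ≤ a * (a - 2) / (a - 1) := by
    apply div_nonneg (mul_nonneg _ _) <;> linarith
  have hc1 : a * (a - 2) / (a - 1) ≤ a := by
    rw [div_le_iff₀ (by linarith)]; nlinarith
  have hp : 0 ≤ a * t ^ x := by positivity
  unfold U0
  split_ifs with h1 h2 h3
  · rw [abs_of_nonneg (by positivity)]
    have : lam ^ x ≤ t ^ x := by
      obtain ⟨n, rfl⟩ : ∃ n : ℕ, x = -(n : ℤ) := ⟨x.natAbs, by omega⟩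
      rw [zpow_neg, zpow_neg, zpow_natCast, zpow_natCast]
      gcongr
    gcongr
  · subst h3; rw [abs_of_nonneg (by linarith)]; simp
  · simpa using hp
  · simpa using hp

lemma U_lim (a lam : ℝ) (ha : 2 < a) (hlam : 0 < lam) (hl1 : lam < 1) (N : ℕ) (x : ℤ) :
    |ev (U0 a lam) N x - (if Even (x + N) then
      a * (a - 2) / (a - 1) * (lam + lam⁻¹) ^ N * lam ^ x else 0)| ≤ a * 2 ^ N := by
  have hc0 : 0 ≤ a * (a - 2) / (a - 1) := by
    apply div_nonneg (mul_nonneg _ _) <;> linarith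
  have hc1 : a * (a - 2) / (a - 1) ≤ a := by
    rw [div_le_iff₀ (by linarith)]; nlinarith
  set c := a * (a - 2) / (a - 1) with hc
  let E : ℤ → ℝ := fun x => U0 a lam x - (if Even x then c * lam ^ x else 0)
  have hE : U0 a lam = fun x => E x + (if Even x then c * lam ^ x else 0) := by
    funext x; simp only [E]; ring
  rw [hE, ev_add, ev_eig c lam hlam, add_sub_cancel_right]
  have := ev_bound E a 1 one_pos (by
    intro x
    rw [one_zpow, mul_one]
    simp only [E]
    unfold U0
    split_ifs with h1 h2 h3
    · rw [← hc, sub_self, abs_zero]; linarith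
    · subst h3; simp; rw [abs_le]; constructor <;> linarith
    · rw [zero_sub, abs_neg, abs_of_nonneg (by positivity)]
      have : lam ^ x ≤ 1 := by
        obtain ⟨n, rfl⟩ : ∃ n : ℕ, x = (n : ℤ) := ⟨x.natAbs, by omega⟩
        rw [zpow_natCast]
        exact pow_le_one₀ hlam.le hl1.le
      calc c * lam ^ x ≤ c * 1 := by gcongr
        _ ≤ a := by linarith
    · simp; linarith) N x
  norm_num at this
  exact this

lemma U_tend (a lam : ℝ) (ha : 2 < a) (hlam : 0 < lam) (hl1 : lam < 1) (p : ℕ) (x : ℤ) :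
    Tendsto (fun j : ℕ => ev (U0 a lam) (2 * j + p) x / (lam + lam⁻¹) ^ (2 * j + p)) atTop
      (nhds (if Even (x + p) then a * (a - 2) / (a - 1) * lam ^ x else 0)) := by
  have hmu : 2 < lam + lam⁻¹ := by
    have : lam + lam⁻¹ - 2 = (1 - lam) ^ 2 / lam := by field_simp; ring
    have h2 : 0 < (1 - lam) ^ 2 / lam := div_pos (pow_pos (by linarith) 2) hlam
    linarith
  set mu := lam + lam⁻¹ with hmudef
  have hpos : ∀ N : ℕ, 0 < mu ^ N := fun N => pow_pos (by linarith) N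
  rw [tendsto_iff_norm_sub_tendsto_zero]
  have hb : Tendsto (fun N : ℕ => a * (2 / mu) ^ N) atTop (nhds 0) := by
    have := (tendsto_pow_atTop_nhds_zero_of_lt_one (r := 2 / mu) (by positivity)
      (by rw [div_lt_one (by linarith)]; exact hmu)).const_mul a
    simpa using this
  have hN : Tendsto (fun j : ℕ => 2 * j + p) atTop atTop :=
    tendsto_atTop_mono (fun j => by simp only [id]; omega) tendsto_id
  refine squeeze_zero (fun _ => norm_nonneg _) (fun j => ?_) (hb.comp hN)
  have h := U_lim a lam ha hlam hl1 (2 * j + p) x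
  have he : Even (x + ((2 * j + p : ℕ) : ℤ)) ↔ Even (x + p) := by
    push_cast
    rw [show x + (2 * (j : ℤ) + p) = (x + p) + 2 * j by ring]
    simp [Int.even_add]
  simp only [he] at h
  rw [← hmudef] at h
  simp only [Function.comp]
  rw [div_pow, ← mul_div_assoc, le_div_iff₀ (hpos _), Real.norm_eq_abs,
    ← abs_of_pos (hpos (2 * j + p)), ← abs_mul, abs_of_pos (hpos (2 * j + p))]
  refine le_trans (le_of_eq (congrArg _ ?_)) h
  rw [sub_mul, div_mul_cancel₀ _ (hpos _).ne']
  split_ifs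
  · ring
  · ring

lemma card_bound (N m : ℕ) : ((Finset.Icc (-((N : ℤ) + 2)) ((m : ℤ) + 1)).card : ℝ) ≤ (N : ℝ) + m + 4 := by
  rw [Int.card_Icc]
  have : ((m : ℤ) + 1 + 1 - -((N : ℤ) + 2)).toNat = N + m + 4 := by omega
  rw [this]; push_cast; exact le_rfl

lemma R_le (a y : ℝ) (hy : 1 < y) (N m : ℕ) :
    ∑ k ∈ Finset.Icc m N, ev (V0 a) N ((k + 2 : ℕ) : ℤ) ^ 2 * y ^ (k + 2) ≤ JJ a y N 0 := by
  have hy0 : 0 < y := by linarith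
  have hP := parseval a y hy0 N 0
  simp only [mul_zero, add_zero] at hP
  obtain ⟨e, he⟩ : ∃ e : ℕ ↪ ℤ, ∀ k, e k = ((k + 2 : ℕ) : ℤ) :=
    ⟨⟨fun k => ((k + 2 : ℕ) : ℤ), fun i j h => by simpa using h⟩, fun _ => rfl⟩
  have := sum_le_hasSum ((Finset.Icc m N).map e) (fun x _ => by
    have : 0 ≤ ev (V0 a) N x * ev (V0 a) N x := mul_self_nonneg _
    positivity) hP
  rw [Finset.sum_map] at this
  refine le_trans (le_of_eq ?_) this
  apply Finset.sum_congr rfl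
  intro k _
  simp only [he]
  rw [zpow_natCast]; ring

lemma R_ge (a y C : ℝ) (hy : 1 < y) (hC : 0 < C)
    (hV : ∀ (N : ℕ) (x : ℤ), |ev (V0 a) N x| ≤ C * 2 ^ N) (N m : ℕ) :
    JJ a y N 0 ≤ ∑ k ∈ Finset.Icc m N, ev (V0 a) N ((k + 2 : ℕ) : ℤ) ^ 2 * y ^ (k + 2)
      + ((N : ℝ) + m + 4) * (C ^ 2 * 4 ^ N * y ^ (m + 1)) := by
  have hy0 : 0 < y := by linarith
  have hP := parseval a y hy0 N 0
  simp only [mul_zero, add_zero] at hP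
  obtain ⟨e, he⟩ : ∃ e : ℕ ↪ ℤ, ∀ k, e k = ((k + 2 : ℕ) : ℤ) :=
    ⟨⟨fun k => ((k + 2 : ℕ) : ℤ), fun i j h => by simpa using h⟩, fun _ => rfl⟩
  have hd : Disjoint ((Finset.Icc m N).map e) (Finset.Icc (-((N : ℤ) + 2)) ((m : ℤ) + 1)) := by
    rw [Finset.disjoint_left]
    intro x hx hx2
    simp only [Finset.mem_map, Finset.mem_Icc, he] at hx hx2
    obtain ⟨k, hk, rfl⟩ := hx
    push_cast at hx2
    omega
  have hS := hasSum_sum_of_ne_finset_zero (L := SummationFilter.unconditional ℤ)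
    (s := (Finset.Icc m N).map e ∪ Finset.Icc (-((N : ℤ) + 2)) ((m : ℤ) + 1))
    (f := fun x : ℤ => ev (V0 a) N x * ev (V0 a) N x * y ^ x) (by
      intro x hx
      rw [Finset.mem_union, not_or] at hx
      rw [V_supp a N x, zero_mul, zero_mul]
      by_contra hcon
      rw [not_lt, abs_le] at hcon
      apply hx.1
      simp only [Finset.mem_map, Finset.mem_Icc, he]
      have h2 := hx.2
      rw [Finset.mem_Icc, not_and] at h2
      have h3 := h2 (by omega)
      exact ⟨(x - 2).toNat, by omega, by omega⟩)
  rw [hP.unique hS, Finset.sum_union hd]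
  apply add_le_add
  · rw [Finset.sum_map]
    apply le_of_eq
    apply Finset.sum_congr rfl
    intro k _
    simp only [he]
    rw [zpow_natCast]; ring
  · calc ∑ x ∈ Finset.Icc (-((N : ℤ) + 2)) ((m : ℤ) + 1), ev (V0 a) N x * ev (V0 a) N x * y ^ x
        ≤ ∑ x ∈ Finset.Icc (-((N : ℤ) + 2)) ((m : ℤ) + 1), C ^ 2 * 4 ^ N * y ^ (m + 1) := by
          apply Finset.sum_le_sum
          intro x hx
          have h1 : ev (V0 a) N x * ev (V0 a) N x ≤ C ^ 2 * 4 ^ N := by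
            rw [← abs_mul_abs_self]
            calc |ev (V0 a) N x| * |ev (V0 a) N x| ≤ (C * 2 ^ N) * (C * 2 ^ N) :=
                  mul_le_mul (hV N x) (hV N x) (abs_nonneg _) (by positivity)
              _ = _ := by rw [show (4 : ℝ) = 2 * 2 by norm_num, mul_pow]; ring
          have h2 : y ^ x ≤ y ^ (m + 1) := by
            rw [← zpow_natCast]
            apply zpow_le_zpow_right₀ hy.le
            have := (Finset.mem_Icc.1 hx).2
            push_cast; exact this
          have h3 : 0 < y ^ x := by positivity
          exact mul_le_mul h1 h2 h3.le (by positivity)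
      _ ≤ _ := by
          rw [Finset.sum_const, nsmul_eq_mul]
          exact mul_le_mul_of_nonneg_right (card_bound N m) (by positivity)

/-- growth constant of upper path -/
noncomputable def KK (a y : ℝ) : ℝ :=
  (y - a / (a - 1) + 1 / (a - 1) / y) ^ 2 * ((1 + y) / (2 * Real.sqrt (Real.pi * y)))

lemma R_tend (a y : ℝ) (ha : 2 < a) (hy : 1 < y) (m : ℕ) :
    Tendsto (fun N : ℕ => (∑ k ∈ Finset.Icc m N, ev (V0 a) N ((k + 2 : ℕ) : ℤ) ^ 2 * y ^ (k + 2)) /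
      (((1 + y) ^ 2 / y) ^ N / Real.sqrt N)) atTop (nhds (KK a y)) := by
  have hy0 : 0 < y := by linarith
  have hJ := JJ_asymp a y (by linarith) hy0
  obtain ⟨C, hC, hV⟩ := V_bound a
  have hβ : 4 < (1 + y) ^ 2 / y := by
    rw [lt_div_iff₀ hy0]; nlinarith [sq_pos_of_pos (sub_pos.2 hy)]
  set β := (1 + y) ^ 2 / y with hβd
  have hβ0 : 0 < β := by linarith
  have hg := (polygeo (4 / β) (by positivity) (by rw [div_lt_one hβ0]; exact hβ)).const_mul
    (((m : ℝ) + 4) * (C ^ 2 * y ^ (m + 1)))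
  rw [mul_zero] at hg
  have hlow := hJ.sub hg
  rw [sub_zero] at hlow
  refine tendsto_of_tendsto_of_tendsto_of_le_of_le' hlow hJ ?_ ?_
  · filter_upwards [eventually_gt_atTop 0] with N hN
    have hN1 : (1 : ℝ) ≤ N := by exact_mod_cast hN
    have hs : 0 < Real.sqrt N := Real.sqrt_pos.2 (by linarith)
    have hsN : Real.sqrt N ≤ (N : ℝ) + 1 := by
      rw [Real.sqrt_le_left (by linarith)]; nlinarith
    have hge := R_ge a y C hy hC hV N m
    rw [sub_le_iff_le_add, ← sub_le_iff_le_add', ← sub_div, div_le_iff₀ (by positivity)]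
    have h4 : 0 < C ^ 2 * y ^ (m + 1) := by positivity
    calc _ ≤ ((N : ℝ) + m + 4) * (C ^ 2 * 4 ^ N * y ^ (m + 1)) := by linarith
      _ ≤ (((m : ℝ) + 4) * ((N : ℝ) + 1) ^ 2) * ((N + 1) / Real.sqrt N) *
            (C ^ 2 * 4 ^ N * y ^ (m + 1)) := by
          apply mul_le_mul_of_nonneg_right _ (by positivity)
          have h5 : 1 ≤ ((N : ℝ) + 1) / Real.sqrt N := by rw [le_div_iff₀ hs]; linarith
          have h6 : (N : ℝ) + m + 4 ≤ ((m : ℝ) + 4) * ((N : ℝ) + 1) ^ 2 := by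
            have : (0 : ℝ) ≤ m := by positivity
            nlinarith [mul_nonneg this (sq_nonneg (N : ℝ)), mul_nonneg this (by linarith : (0 : ℝ) ≤ N)]
          calc _ ≤ ((m : ℝ) + 4) * ((N : ℝ) + 1) ^ 2 * 1 := by linarith
            _ ≤ _ := by gcongr
      _ = _ := by
          rw [div_pow]
          field_simp
  · filter_upwards with N
    gcongr
    exact R_le a y hy N m


lemma X_swap (u v : ℕ → ℝ) (N : ℕ) :
    ∑ k ∈ Finset.range (N + 1), ∑ m ∈ Finset.Icc 1 k, u m * v k =
      ∑ i ∈ Finset.range N, u (i + 1) * ∑ k ∈ Finset.Icc (i + 1) N, v k := by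
  rw [Finset.sum_comm' (t' := Finset.Icc 1 N) (s' := fun m => Finset.Icc m N)]
  · rw [Finset.range_eq_Ico, Finset.sum_Ico_add' (fun m => u m * ∑ k ∈ Finset.Icc m N, v k) 0 N 1]
    apply Finset.sum_congr
    · ext m; simp only [Finset.mem_Icc, Finset.mem_Ico]; omega
    intro m _
    rw [Finset.mul_sum]
  · intro k m
    simp only [Finset.mem_range, Finset.mem_Icc]
    omega

/-- parity-dependent geometric sum -/
noncomputable def Sp (c r : ℝ) (p : ℕ) : ℝ :=
  if p = 0 then c ^ 2 * (r ^ 2 / (1 - r ^ 2)) else c ^ 2 * (r / (1 - r ^ 2))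

lemma S_hasSum (c r lam : ℝ) (h0 : 0 < r) (h1 : r < 1) (hr : lam ^ 2 = r) (p : ℕ) (hp : p < 2) :
    HasSum (fun i : ℕ => (if Even (((i + 1 : ℕ) : ℤ) + p) then c * lam ^ ((i + 1 : ℕ) : ℤ) else 0) ^ 2)
      (Sp c r p) := by
  have hg : HasSum (fun i : ℕ => (r ^ 2) ^ i) ((1 - r ^ 2)⁻¹) :=
    hasSum_geometric_of_lt_one (by positivity) (by nlinarith)
  have hz : HasSum (fun _ : ℕ => (0 : ℝ)) 0 := hasSum_zero
  interval_cases p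
  · have h2 := hg.mul_left (c ^ 2 * r ^ 2)
    have : Sp c r 0 = 0 + c ^ 2 * r ^ 2 * (1 - r ^ 2)⁻¹ := by
      simp only [Sp, if_true]; ring
    rw [this]
    apply HasSum.even_add_odd
    · refine hz.congr_fun fun k => ?_
      rw [if_neg]
      · norm_num
      · push_cast; rw [Int.not_even_iff]; omega
    · refine h2.congr_fun fun k => ?_
      rw [if_pos, zpow_natCast, ← hr]
      · ring
      · push_cast; rw [Int.even_iff]; omega
  · have h2 := hg.mul_left (c ^ 2 * r)
    have : Sp c r 1 = c ^ 2 * r * (1 - r ^ 2)⁻¹ + 0 := by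
      simp only [Sp]; rw [if_neg one_ne_zero]; ring
    rw [this]
    apply HasSum.even_add_odd
    · refine h2.congr_fun fun k => ?_
      rw [if_pos, zpow_natCast, ← hr]
      · ring
      · push_cast; rw [Int.even_iff]; omega
    · refine hz.congr_fun fun k => ?_
      rw [if_neg]
      · norm_num
      · push_cast; rw [Int.not_even_iff]; omega

/-- normalisation -/
noncomputable def DD (mu β : ℝ) (N : ℕ) : ℝ := (mu ^ N) ^ 2 * (β ^ N / Real.sqrt N)

lemma X_tend (a y lam : ℝ) (ha : 2 < a) (hy : 1 < y) (hlam : 0 < lam) (hl1 : lam < 1)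
    (p : ℕ) (hp : p < 2) :
    Tendsto (fun j : ℕ => (∑ k ∈ Finset.range (2 * j + p + 1), ∑ m ∈ Finset.Icc 1 k,
        ev (U0 a lam) (2 * j + p) m ^ 2 *
          (ev (V0 a) (2 * j + p) ((k + 2 : ℕ) : ℤ) ^ 2 * y ^ (k + 2))) /
        DD (lam + lam⁻¹) ((1 + y) ^ 2 / y) (2 * j + p)) atTop
      (nhds (Sp (a * (a - 2) / (a - 1)) (lam ^ 2) p * KK a y)) := by
  have hy0 : 0 < y := by linarith
  have hr1 : lam ^ 2 < 1 := by nlinarith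
  have hmu0 : 0 < lam + lam⁻¹ := by positivity
  have hN : Tendsto (fun j : ℕ => 2 * j + p) atTop atTop :=
    tendsto_atTop_mono (fun j => by simp only [id]; omega) tendsto_id
  let R : ℕ → ℕ → ℝ := fun N m =>
    ∑ k ∈ Finset.Icc m N, ev (V0 a) N ((k + 2 : ℕ) : ℤ) ^ 2 * y ^ (k + 2)
  let B : ℕ → ℝ := fun N => ((1 + y) ^ 2 / y) ^ N / Real.sqrt N
  have hB0 : ∀ N, 0 ≤ B N := fun N => by positivity
  have hR0 : ∀ N m, 0 ≤ R N m := fun N m => Finset.sum_nonneg fun k _ => by positivity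
  let f : ℕ → ℕ → ℝ := fun j i =>
    (ev (U0 a lam) (2 * j + p) ((i + 1 : ℕ) : ℤ) / (lam + lam⁻¹) ^ (2 * j + p)) ^ 2 *
      (R (2 * j + p) (i + 1) / B (2 * j + p))
  have hf : ∀ j, (∑ k ∈ Finset.range (2 * j + p + 1), ∑ m ∈ Finset.Icc 1 k,
        ev (U0 a lam) (2 * j + p) m ^ 2 *
          (ev (V0 a) (2 * j + p) ((k + 2 : ℕ) : ℤ) ^ 2 * y ^ (k + 2))) /
        DD (lam + lam⁻¹) ((1 + y) ^ 2 / y) (2 * j + p) = ∑' i, f j i := by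
    intro j
    rw [X_swap (fun m => ev (U0 a lam) (2 * j + p) m ^ 2)
      (fun k => ev (V0 a) (2 * j + p) ((k + 2 : ℕ) : ℤ) ^ 2 * y ^ (k + 2)),
      tsum_eq_sum (s := Finset.range (2 * j + p))]
    · rw [Finset.sum_div]
      apply Finset.sum_congr rfl
      intro i _
      simp only [f, R, B, DD]
      rw [← div_mul_div_comm, ← div_pow]
    · intro i hi
      simp only [Finset.mem_range, not_lt] at hi
      have : R (2 * j + p) (i + 1) = 0 := by
        simp only [R]
        rw [Finset.Icc_eq_empty (by omega), Finset.sum_empty]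
      simp only [f, this, zero_div, mul_zero]
  simp only [hf]
  have hlim := (S_hasSum (a * (a - 2) / (a - 1)) (lam ^ 2) lam (by positivity) hr1 rfl p hp).mul_right
    (KK a y)
  rw [← hlim.tsum_eq]
  have hJ := (JJ_asymp a y (by linarith) hy0).comp hN
  have hev : ∀ᶠ j : ℕ in atTop, JJ a y (2 * j + p) 0 / B (2 * j + p) ≤ KK a y + 1 := by
    have hlt : (y - a / (a - 1) + 1 / (a - 1) / y) ^ 2 * ((1 + y) / (2 * Real.sqrt (Real.pi * y))) <
      KK a y + 1 := lt_add_one (KK a y)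
    exact hJ.eventually_le_const hlt
  apply tendsto_tsum_of_dominated_convergence
    (bound := fun i => a ^ 2 * (KK a y + 1) * (lam ^ 2) ^ (i + 1))
  · apply Summable.mul_left
    exact (summable_nat_add_iff 1).2 (summable_geometric_of_lt_one (by positivity) hr1)
  · intro i
    exact ((U_tend a lam ha hlam hl1 p ((i + 1 : ℕ) : ℤ)).pow 2).mul
      ((R_tend a y ha hy (i + 1)).comp hN)
  · filter_upwards [hev] with j hj i
    have hq : R (2 * j + p) (i + 1) / B (2 * j + p) ≤ KK a y + 1 :=
      le_trans (div_le_div_of_nonneg_right (R_le a y hy _ _) (hB0 _)) hj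
    have hq0 : 0 ≤ R (2 * j + p) (i + 1) / B (2 * j + p) := div_nonneg (hR0 _ _) (hB0 _)
    have hu := U_bound a lam lam ha hlam le_rfl (2 * j + p) ((i + 1 : ℕ) : ℤ)
    have hu2 : |ev (U0 a lam) (2 * j + p) ((i + 1 : ℕ) : ℤ) / (lam + lam⁻¹) ^ (2 * j + p)| ≤
        a * lam ^ (i + 1) := by
      rw [abs_div, abs_of_pos (pow_pos hmu0 _), div_le_iff₀ (pow_pos hmu0 _)]
      rw [zpow_natCast] at hu
      linarith
    have hu3 : (ev (U0 a lam) (2 * j + p) ((i + 1 : ℕ) : ℤ) / (lam + lam⁻¹) ^ (2 * j + p)) ^ 2 ≤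
        (a * lam ^ (i + 1)) ^ 2 := by
      rw [← sq_abs]; exact pow_le_pow_left₀ (abs_nonneg _) hu2 2
    simp only [f]
    rw [Real.norm_of_nonneg (mul_nonneg (sq_nonneg _) hq0)]
    calc _ ≤ (a * lam ^ (i + 1)) ^ 2 * (KK a y + 1) :=
          mul_le_mul hu3 hq hq0 (by positivity)
      _ = _ := by ring

lemma Y_tend (a y lam : ℝ) (ha : 2 < a) (hy : 1 < y) (hlam : 0 < lam) (hl1 : lam < 1) :
    Tendsto (fun N : ℕ => (∑ k ∈ Finset.range (N + 1), ∑ m ∈ Finset.Icc 1 k,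
        ev (U0 a lam) N ((k + 2 : ℕ) : ℤ) ^ 2 * ev (V0 a) N m ^ 2 * y ^ (k + 2)) /
        DD (lam + lam⁻¹) ((1 + y) ^ 2 / y) N) atTop (nhds 0) := by
  have hy0 : 0 < y := by linarith
  obtain ⟨C, hC, hV⟩ := V_bound a
  have hβ : 4 < (1 + y) ^ 2 / y := by
    rw [lt_div_iff₀ hy0]; nlinarith [sq_pos_of_pos (sub_pos.2 hy)]
  have hmu : 2 < lam + lam⁻¹ := by
    have : lam + lam⁻¹ - 2 = (1 - lam) ^ 2 / lam := by field_simp; ring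
    have h2 : 0 < (1 - lam) ^ 2 / lam := div_pos (pow_pos (by linarith) 2) hlam
    linarith
  obtain ⟨t, ht0, htl, hty, htq⟩ : ∃ t : ℝ, 0 < t ∧ t ≤ lam ∧ t ^ 2 * y ≤ 1 ∧
      4 * (t + t⁻¹) ^ 2 < (lam + lam⁻¹) ^ 2 * ((1 + y) ^ 2 / y) := by
    have hs : 0 < Real.sqrt y := Real.sqrt_pos.2 hy0
    have hs2 : Real.sqrt y ^ 2 = y := Real.sq_sqrt hy0.le
    rcases le_total lam (1 / Real.sqrt y) with h | h
    · refine ⟨lam, hlam, le_rfl, ?_, ?_⟩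
      · have : lam ^ 2 ≤ (1 / Real.sqrt y) ^ 2 := pow_le_pow_left₀ hlam.le h 2
        rw [div_pow, hs2, one_pow, le_div_iff₀ hy0] at this
        exact this
      · have : 0 < (lam + lam⁻¹) ^ 2 := by positivity
        nlinarith
    · refine ⟨1 / Real.sqrt y, by positivity, h, ?_, ?_⟩
      · rw [div_pow, hs2, one_pow, one_div, inv_mul_cancel₀ hy0.ne']
      · have : (1 / Real.sqrt y + (1 / Real.sqrt y)⁻¹) ^ 2 = (1 + y) ^ 2 / y := by
          rw [one_div, inv_inv, inv_eq_one_div, div_add' _ _ _ hs.ne', div_pow, hs2, ← pow_two, hs2]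
        rw [this]
        have : 4 < (lam + lam⁻¹) ^ 2 := by nlinarith
        nlinarith
  set mu := lam + lam⁻¹ with hmud
  set β := (1 + y) ^ 2 / y with hβd
  have hmu0 : 0 < mu := by linarith
  have hβ0 : 0 < β := by linarith
  set Q := 4 * (t + t⁻¹) ^ 2 with hQ
  have hQ0 : 0 < Q := by positivity
  have hg := (polygeo (Q / (mu ^ 2 * β)) (by positivity)
    (by rw [div_lt_one (by positivity)]; exact htq)).const_mul (a ^ 2 * C ^ 2)
  rw [mul_zero] at hg
  refine squeeze_zero (fun N => ?_) (fun N => ?_) hg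
  · unfold DD
    refine div_nonneg (Finset.sum_nonneg fun k _ => Finset.sum_nonneg fun m _ => ?_) ?_ <;> positivity
  · have hterm : ∀ k m : ℕ, ev (U0 a lam) N ((k + 2 : ℕ) : ℤ) ^ 2 * ev (V0 a) N m ^ 2 * y ^ (k + 2)
        ≤ a ^ 2 * C ^ 2 * Q ^ N := by
      intro k m
      have hu := U_bound a lam t ha ht0 htl N ((k + 2 : ℕ) : ℤ)
      rw [zpow_natCast] at hu
      have hu2 := pow_le_pow_left₀ (abs_nonneg _) hu 2
      have hv2 := pow_le_pow_left₀ (abs_nonneg _) (hV N m) 2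
      rw [sq_abs] at hu2 hv2
      have hty' : (t ^ 2 * y) ^ (k + 2) ≤ 1 := pow_le_one₀ (by positivity) hty
      calc _ ≤ (a * (t + t⁻¹) ^ N * t ^ (k + 2)) ^ 2 * (C * 2 ^ N) ^ 2 * y ^ (k + 2) := by gcongr
        _ = a ^ 2 * C ^ 2 * Q ^ N * (t ^ 2 * y) ^ (k + 2) := by
            have h4 : (4 : ℝ) ^ N = (2 ^ N) ^ 2 := by
              rw [← pow_mul, mul_comm, pow_mul]; norm_num
            rw [hQ, mul_pow 4, h4]; generalize t + t⁻¹ = w; ring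
        _ ≤ a ^ 2 * C ^ 2 * Q ^ N * 1 := by gcongr
        _ = _ := mul_one _
    have hsum : ∑ k ∈ Finset.range (N + 1), ∑ m ∈ Finset.Icc 1 k,
        ev (U0 a lam) N ((k + 2 : ℕ) : ℤ) ^ 2 * ev (V0 a) N m ^ 2 * y ^ (k + 2) ≤
        ((N : ℝ) + 1) * (((N : ℝ) + 1) * (a ^ 2 * C ^ 2 * Q ^ N)) := by
      calc _ ≤ ∑ k ∈ Finset.range (N + 1), (((N : ℝ) + 1) * (a ^ 2 * C ^ 2 * Q ^ N)) := by
            apply Finset.sum_le_sum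
            intro k hk
            calc _ ≤ ∑ m ∈ Finset.Icc 1 k, (a ^ 2 * C ^ 2 * Q ^ N) :=
                  Finset.sum_le_sum fun m _ => hterm k m
              _ ≤ _ := by
                  rw [Finset.sum_const, Nat.card_Icc, nsmul_eq_mul]
                  have : ((k + 1 - 1 : ℕ) : ℝ) ≤ (N : ℝ) + 1 := by
                    have := Finset.mem_range.1 hk
                    exact_mod_cast (by omega : k + 1 - 1 ≤ N + 1)
                  exact mul_le_mul_of_nonneg_right this (by positivity)
        _ = _ := by rw [Finset.sum_const, Finset.card_range, nsmul_eq_mul]; push_cast; ring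
    have hsN : Real.sqrt N ≤ (N : ℝ) + 1 := by
      have : (0 : ℝ) ≤ N := Nat.cast_nonneg N
      rw [Real.sqrt_le_left (by linarith)]; nlinarith
    have hD : (DD mu β N)⁻¹ = Real.sqrt N / ((mu ^ 2 * β) ^ N) := by
      unfold DD
      rw [← mul_div_assoc, inv_div, mul_pow, ← pow_mul, ← pow_mul, mul_comm N 2]
    rw [div_eq_mul_inv, hD]
    calc _ ≤ ((N : ℝ) + 1) * (((N : ℝ) + 1) * (a ^ 2 * C ^ 2 * Q ^ N)) *
          (((N : ℝ) + 1) / ((mu ^ 2 * β) ^ N)) := by gcongr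
      _ = _ := by rw [div_pow]; ring

lemma cs_bound {ι : Type*} (s : Finset ι) (A B w : ι → ℝ) (hw : ∀ i, 0 ≤ w i) :
    |∑ i ∈ s, (A i - B i) ^ 2 * w i - ∑ i ∈ s, A i ^ 2 * w i| ≤
      ∑ i ∈ s, B i ^ 2 * w i +
        2 * Real.sqrt ((∑ i ∈ s, A i ^ 2 * w i) * ∑ i ∈ s, B i ^ 2 * w i) := by
  have h := Finset.sum_mul_sq_le_sq_mul_sq s (fun i => A i * Real.sqrt (w i))
    (fun i => B i * Real.sqrt (w i))
  have e1 : ∀ i, (A i * Real.sqrt (w i)) ^ 2 = A i ^ 2 * w i := fun i => by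
    rw [mul_pow, Real.sq_sqrt (hw i)]
  have e2 : ∀ i, (B i * Real.sqrt (w i)) ^ 2 = B i ^ 2 * w i := fun i => by
    rw [mul_pow, Real.sq_sqrt (hw i)]
  have e3 : ∀ i, A i * Real.sqrt (w i) * (B i * Real.sqrt (w i)) = A i * B i * w i := fun i => by
    calc _ = A i * B i * (Real.sqrt (w i)) ^ 2 := by ring
      _ = _ := by rw [Real.sq_sqrt (hw i)]
  simp only [e1, e2, e3] at h
  have h2 := Real.abs_le_sqrt h
  have hB : 0 ≤ ∑ i ∈ s, B i ^ 2 * w i := Finset.sum_nonneg fun i _ => mul_nonneg (sq_nonneg _) (hw i)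
  have e4 : ∑ i ∈ s, (A i - B i) ^ 2 * w i - ∑ i ∈ s, A i ^ 2 * w i =
      ∑ i ∈ s, B i ^ 2 * w i - 2 * ∑ i ∈ s, A i * B i * w i := by
    rw [Finset.mul_sum, ← Finset.sum_sub_distrib, ← Finset.sum_sub_distrib]
    apply Finset.sum_congr rfl
    intro i _; ring
  rw [e4, abs_le]
  rw [abs_le] at h2
  constructor <;> linarith [h2.1, h2.2]

lemma T_tend (a y lam : ℝ) (ha : 2 < a) (hy : 1 < y) (hlam : 0 < lam) (hl1 : lam < 1)
    (hl2 : lam ^ 2 * (a - 1) = 1) (p : ℕ) (hp : p < 2) :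
    Tendsto (fun j : ℕ => (∑ k ∈ Finset.range (2 * j + p + 1), ∑ m ∈ Finset.Icc 1 k,
        (sW a (2 * j + p) k m) ^ 2 * y ^ (k + 2)) /
        DD (lam + lam⁻¹) ((1 + y) ^ 2 / y) (2 * j + p)) atTop
      (nhds (Sp (a * (a - 2) / (a - 1)) (lam ^ 2) p * KK a y)) := by
  have hy0 : 0 < y := by linarith
  have hN : Tendsto (fun j : ℕ => 2 * j + p) atTop atTop :=
    tendsto_atTop_mono (fun j => by simp only [id]; omega) tendsto_id
  have hX := X_tend a y lam ha hy hlam hl1 p hp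
  have hY := (Y_tend a y lam ha hy hlam hl1).comp hN
  have hD0 : ∀ N, 0 ≤ DD (lam + lam⁻¹) ((1 + y) ^ 2 / y) N := fun N => by unfold DD; positivity
  set D := DD (lam + lam⁻¹) ((1 + y) ^ 2 / y) with hD
  have hXY := hX.mul hY
  rw [mul_zero] at hXY
  have hZ := (hXY.sqrt.const_mul 2)
  rw [Real.sqrt_zero, mul_zero] at hZ
  have hE := hY.add hZ
  rw [add_zero] at hE
  have hdiff : Tendsto (fun j : ℕ => (∑ k ∈ Finset.range (2 * j + p + 1), ∑ m ∈ Finset.Icc 1 k,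
        (sW a (2 * j + p) k m) ^ 2 * y ^ (k + 2)) / D (2 * j + p) -
        (∑ k ∈ Finset.range (2 * j + p + 1), ∑ m ∈ Finset.Icc 1 k,
        ev (U0 a lam) (2 * j + p) m ^ 2 *
          (ev (V0 a) (2 * j + p) ((k + 2 : ℕ) : ℤ) ^ 2 * y ^ (k + 2))) / D (2 * j + p)) atTop (nhds 0) := by
    rw [tendsto_zero_iff_norm_tendsto_zero]
    refine squeeze_zero (fun _ => norm_nonneg _) (fun j => ?_) hE
    simp only [Function.comp]
    generalize 2 * j + p = N
    have hcs := cs_bound ((Finset.range (N + 1)).sigma (fun k => Finset.Icc 1 k))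
      (fun i => ev (U0 a lam) N i.2 * ev (V0 a) N ((i.1 + 2 : ℕ) : ℤ))
      (fun i => ev (U0 a lam) N ((i.1 + 2 : ℕ) : ℤ) * ev (V0 a) N i.2)
      (fun i => y ^ (i.1 + 2)) (fun i => by positivity)
    simp only [Finset.sum_sigma] at hcs
    have e1 : ∑ k ∈ Finset.range (N + 1), ∑ m ∈ Finset.Icc 1 k, (sW a N k m) ^ 2 * y ^ (k + 2) =
        ∑ k ∈ Finset.range (N + 1), ∑ m ∈ Finset.Icc 1 k,
        (ev (U0 a lam) N m * ev (V0 a) N ((k + 2 : ℕ) : ℤ) -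
          ev (U0 a lam) N ((k + 2 : ℕ) : ℤ) * ev (V0 a) N m) ^ 2 * y ^ (k + 2) := by
      refine Finset.sum_congr rfl fun k _ => Finset.sum_congr rfl fun m hm => ?_
      rw [sW_det a lam ha hlam hl2 N k m (Finset.mem_Icc.1 hm).2]
    have e2 : ∑ k ∈ Finset.range (N + 1), ∑ m ∈ Finset.Icc 1 k, ev (U0 a lam) N m ^ 2 *
          (ev (V0 a) N ((k + 2 : ℕ) : ℤ) ^ 2 * y ^ (k + 2)) =
        ∑ k ∈ Finset.range (N + 1), ∑ m ∈ Finset.Icc 1 k,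
        (ev (U0 a lam) N m * ev (V0 a) N ((k + 2 : ℕ) : ℤ)) ^ 2 * y ^ (k + 2) := by
      refine Finset.sum_congr rfl fun k _ => Finset.sum_congr rfl fun m hm => ?_
      ring
    have e3 : ∑ k ∈ Finset.range (N + 1), ∑ m ∈ Finset.Icc 1 k,
        ev (U0 a lam) N ((k + 2 : ℕ) : ℤ) ^ 2 * ev (V0 a) N m ^ 2 * y ^ (k + 2) =
        ∑ k ∈ Finset.range (N + 1), ∑ m ∈ Finset.Icc 1 k,
        (ev (U0 a lam) N ((k + 2 : ℕ) : ℤ) * ev (V0 a) N m) ^ 2 * y ^ (k + 2) := by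
      refine Finset.sum_congr rfl fun k _ => Finset.sum_congr rfl fun m hm => ?_
      ring
    rw [e1, e2, e3, ← sub_div, norm_div, Real.norm_eq_abs, Real.norm_of_nonneg (hD0 N),
      div_mul_div_comm, Real.sqrt_div' _ (mul_nonneg (hD0 N) (hD0 N)), Real.sqrt_mul_self (hD0 N),
      ← mul_div_assoc, ← add_div]
    exact div_le_div_of_nonneg_right hcs (hD0 N)
  have := hdiff.add hX
  rw [zero_add] at this
  refine this.congr fun j => ?_
  ring

lemma final_tend (mu β ρ C L : ℝ) (hmu : 0 < mu) (hβ : 0 < β) (hρ : 0 < ρ) (hC : 0 < C)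
    (hρ2 : ρ ^ 2 = mu ^ 2 * β) (hL : L * Real.sqrt 2 = C * ρ ^ 2) (N : ℕ → ℕ) (T : ℕ → ℝ)
    (hN : Tendsto N atTop atTop) (hT : Tendsto (fun j => T j / DD mu β (N j)) atTop (nhds L)) :
    Tendsto (fun j => T j / (C * ((2 * N j + 2 : ℕ) : ℝ) ^ (-(1 : ℝ) / 2) * ρ ^ (2 * N j + 2)))
      atTop (nhds 1) := by
  have hq : Tendsto (fun n : ℕ => Real.sqrt (2 + 2 / (n : ℝ)) / (C * ρ ^ 2)) atTop
      (nhds (Real.sqrt 2 / (C * ρ ^ 2))) := by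
    have h1 : Tendsto (fun n : ℕ => 2 + 2 / (n : ℝ)) atTop (nhds (2 + 0)) :=
      (tendsto_const_div_atTop_nhds_zero_nat 2).const_add 2
    rw [add_zero] at h1
    exact h1.sqrt.div_const _
  have h := hT.mul (hq.comp hN)
  have e : L * (Real.sqrt 2 / (C * ρ ^ 2)) = 1 := by
    rw [← mul_div_assoc, hL, div_self (by positivity)]
  rw [e] at h
  refine h.congr' ?_
  filter_upwards [hN.eventually_gt_atTop 0] with j hj
  simp only [Function.comp]
  have hn : (0 : ℝ) < N j := by exact_mod_cast hj
  have hs : 0 < Real.sqrt (N j) := Real.sqrt_pos.2 hn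
  have hr : ((2 * N j + 2 : ℕ) : ℝ) ^ (-(1 : ℝ) / 2) = (Real.sqrt (2 * N j + 2))⁻¹ := by
    rw [Real.sqrt_eq_rpow, ← Real.rpow_neg (by positivity)]
    push_cast
    congr 1; norm_num
  have hs2 : Real.sqrt (2 + 2 / (N j : ℝ)) = Real.sqrt (2 * N j + 2) / Real.sqrt (N j) := by
    rw [← Real.sqrt_div' _ hn.le]
    congr 1
    field_simp
  have hs3 : 0 < Real.sqrt (2 * (N j : ℝ) + 2) := Real.sqrt_pos.2 (by linarith)
  rw [hr, hs2, pow_add, pow_mul, hρ2]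
  unfold DD
  rw [mul_pow, ← pow_mul mu (N j) 2, ← pow_mul mu 2 (N j), mul_comm (N j) 2]
  field_simp

lemma const_eq (a y r : ℝ) (ha : 2 < a) (hy : 1 < y) (hr : r = 1 / (a - 1)) (p : ℕ) (hp : p < 2) :
    Sp (a * (a - 2) / (a - 1)) r p * KK a y * Real.sqrt 2 =
      (a - 2) * (y - 1) ^ 2 * ((a - 1) * y - 1) ^ 2
              / (Real.sqrt (2 * Real.pi) * a * (a - 1) ^ (3 - p) * y ^ ((3 : ℝ) / 2) * (y + 1)) *
      (a ^ 2 / (a - 1) * ((1 + y) ^ 2 / y)) := by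
  have hy0 : 0 < y := by linarith
  have ha1 : 0 < a - 1 := by linarith
  have ha2 : 0 < a - 2 := by linarith
  have ha0 : 0 < a := by linarith
  have hs : 0 < Real.sqrt y := Real.sqrt_pos.2 hy0
  have hp' : 0 < Real.sqrt Real.pi := Real.sqrt_pos.2 Real.pi_pos
  have h2 : 0 < Real.sqrt 2 := Real.sqrt_pos.2 (by norm_num)
  have h22 : Real.sqrt 2 ^ 2 = 2 := Real.sq_sqrt (by norm_num)
  have hy32 : y ^ ((3 : ℝ) / 2) = y * Real.sqrt y := by
    rw [show (3 : ℝ) / 2 = 1 + 1 / 2 by norm_num, Real.rpow_add hy0, Real.rpow_one, Real.sqrt_eq_rpow]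
  have hk : y - a / (a - 1) + 1 / (a - 1) / y = (y - 1) * ((a - 1) * y - 1) / ((a - 1) * y) := by
    field_simp; ring
  have h1r : 1 - r ^ 2 = a * (a - 2) / (a - 1) ^ 2 := by
    rw [hr]; field_simp; ring
  unfold KK
  rw [hk, hy32, Real.sqrt_mul Real.pi_pos.le, Real.sqrt_mul (by norm_num : (0 : ℝ) ≤ 2)]
  have hy1 : 0 < 1 + y := by linarith
  rw [add_comm y 1]
  interval_cases p
  · simp only [Sp, if_true]
    rw [h1r, hr]
    field_simp
    rw [h22]
    try ring
  · simp only [Sp]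
    rw [if_neg one_ne_zero, h1r, hr]
    field_simp
    rw [h22]
    try ring

lemma main_p (a y : ℝ) (ha : 2 < a) (hy : 1 < y) (p : ℕ) (hp : p < 2) :
    Tendsto (fun j : ℕ =>
        PG2 (2 * (2 * j + p) + 2) a y /
          ((a - 2) * (y - 1) ^ 2 * ((a - 1) * y - 1) ^ 2
              / (Real.sqrt (2 * Real.pi) * a * (a - 1) ^ (3 - p) * y ^ ((3 : ℝ) / 2) * (y + 1))
            * ((2 * (2 * j + p) + 2 : ℕ) : ℝ) ^ (-(1 : ℝ) / 2)
            * (a * (y + 1) / Real.sqrt ((a - 1) * y)) ^ (2 * (2 * j + p) + 2)))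
      atTop (nhds 1) := by
  have hy0 : 0 < y := by linarith
  have ha1 : 0 < a - 1 := by linarith
  have ha2 : 0 < a - 2 := by linarith
  have ha0 : 0 < a := by linarith
  have hs : 0 < Real.sqrt (a - 1) := Real.sqrt_pos.2 ha1
  have hs1 : 1 < Real.sqrt (a - 1) := by
    rw [Real.lt_sqrt (by norm_num)]; linarith
  have hss : Real.sqrt (a - 1) ^ 2 = a - 1 := Real.sq_sqrt ha1.le
  set lam := 1 / Real.sqrt (a - 1) with hlamd
  have hlam : 0 < lam := by positivity
  have hl1 : lam < 1 := by rw [hlamd, div_lt_one hs]; exact hs1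
  have hlr : lam ^ 2 = 1 / (a - 1) := by rw [hlamd, div_pow, hss, one_pow]
  have hl2 : lam ^ 2 * (a - 1) = 1 := by rw [hlr]; field_simp
  have hmu2 : (lam + lam⁻¹) ^ 2 = a ^ 2 / (a - 1) := by
    have : (lam + lam⁻¹) ^ 2 = lam ^ 2 + 2 + (lam ^ 2)⁻¹ := by field_simp; ring
    rw [this, hlr]; field_simp; ring
  have hN : Tendsto (fun j : ℕ => 2 * j + p) atTop atTop :=
    tendsto_atTop_mono (fun j => by simp only [id]; omega) tendsto_id
  have hρ2 : (a * (y + 1) / Real.sqrt ((a - 1) * y)) ^ 2 = (lam + lam⁻¹) ^ 2 * ((1 + y) ^ 2 / y) := by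
    rw [hmu2, div_pow, Real.sq_sqrt (by positivity)]; field_simp; ring
  have hC : 0 < (a - 2) * (y - 1) ^ 2 * ((a - 1) * y - 1) ^ 2
              / (Real.sqrt (2 * Real.pi) * a * (a - 1) ^ (3 - p) * y ^ ((3 : ℝ) / 2) * (y + 1)) := by
    have h1 : 0 < y - 1 := by linarith
    have h2 : 0 < (a - 1) * y - 1 := by nlinarith
    have := Real.pi_pos
    positivity
  refine final_tend (lam + lam⁻¹) ((1 + y) ^ 2 / y) (a * (y + 1) / Real.sqrt ((a - 1) * y)) _
    (Sp (a * (a - 2) / (a - 1)) (lam ^ 2) p * KK a y)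
    (by positivity) (by positivity) (by positivity) hC hρ2 ?_ (fun j => 2 * j + p)
    (fun j => PG2 (2 * (2 * j + p) + 2) a y) hN ?_
  · rw [hρ2, hmu2]
    exact const_eq a y _ ha hy hlr p hp
  · refine (T_tend a y lam ha hy hlam hl1 hl2 p hp).congr fun j => ?_
    unfold PG2
    rw [show (2 * (2 * j + p) + 2 - 2) / 2 = 2 * j + p by omega]


/-- Asymptotics of `P^{G2}_{2n}(a,y)` for `a > 2`, `y > 1`, along `n ≡ 2 (mod 4)` and
along `n ≡ 0 (mod 4)`: in each case the ratio of the two sides tends to `1`. -/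
theorem PG2_asymp_abig_ybig (a y : ℝ) (ha : 2 < a) (hy : 1 < y) :
    Tendsto (fun j : ℕ =>
        PG2 (4 * j + 2) a y /
          ((a - 2) * (y - 1) ^ 2 * ((a - 1) * y - 1) ^ 2
              / (Real.sqrt (2 * Real.pi) * a * (a - 1) ^ 3 * y ^ ((3 : ℝ) / 2) * (y + 1))
            * ((4 * j + 2 : ℕ) : ℝ) ^ (-(1 : ℝ) / 2)
            * (a * (y + 1) / Real.sqrt ((a - 1) * y)) ^ (4 * j + 2)))
      atTop (nhds 1) ∧
    Tendsto (fun j : ℕ =>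
        PG2 (4 * j) a y /
          ((a - 2) * (y - 1) ^ 2 * ((a - 1) * y - 1) ^ 2
              / (Real.sqrt (2 * Real.pi) * a * (a - 1) ^ 2 * y ^ ((3 : ℝ) / 2) * (y + 1))
            * ((4 * j : ℕ) : ℝ) ^ (-(1 : ℝ) / 2)
            * (a * (y + 1) / Real.sqrt ((a - 1) * y)) ^ (4 * j)))
      atTop (nhds 1) := by
  constructor
  · refine (main_p a y ha hy 0 (by norm_num)).congr fun j => ?_
    rw [show 2 * (2 * j + 0) + 2 = 4 * j + 2 by ring]
  · rw [← tendsto_add_atTop_iff_nat 1]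
    refine (main_p a y ha hy 1 (by norm_num)).congr fun j => ?_
    rw [show 2 * (2 * j + 1) + 2 = 4 * (j + 1) by ring]
end
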